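/- For every dimension d ≥ 1 and every ε > 0 there exists δ > 0, depending only on d and ε, such that the following holds. Let μ be a Radon measure on ℝ^d with 1 ≤ μ(B̄(0,1)) and μ(B(0,2)) ≤ 9. If ∫_δ^{δ^{-1}} ∫_{x ∈ B(0, δ^{-1})} Δ_μ(x,r) dμ(x) (dr/r) ≤ δ^{1/2}, then dist_{B(0,2)}(μ, F) < ε, where F denotes the family of 1-flat measures. -/

import Mathlib

open MeasureTheory Metric
open scoped ENNReal NNReal

/-- `Δ_μ(x,r) = |μ(B(x,r))/r − μ(B(x,2r))/(2r)|`. -/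
noncomputable def ballDelta {d : ℕ} (μ : Measure (EuclideanSpace ℝ (Fin d)))
    (x : EuclideanSpace ℝ (Fin d)) (r : ℝ) : ℝ :=
  |(μ (ball x r)).toReal / r - (μ (ball x (2 * r))).toReal / (2 * r)|

/-- `L` is an affine line in `ℝ^d`. -/
def IsLine {d : ℕ} (L : Set (EuclideanSpace ℝ (Fin d))) : Prop :=
  ∃ x v : EuclideanSpace ℝ (Fin d), v ≠ 0 ∧ L = {y | ∃ t : ℝ, y = x + t • v}

/-- A measure is 1-flat if it is a positive multiple of `H^1` restricted to a line. -/
def IsFlat {d : ℕ} (σ : Measure (EuclideanSpace ℝ (Fin d))) : Prop :=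
  ∃ c : ℝ, 0 < c ∧ ∃ L : Set (EuclideanSpace ℝ (Fin d)), IsLine L ∧
    σ = (ENNReal.ofReal c) • (μH[1].restrict L)

/-- `dist_B(σ,ν)`: supremum of `|∫ f dσ − ∫ f dν|` over 1-Lipschitz `f` supported in `B`. -/
noncomputable def distB {d : ℕ} (B : Set (EuclideanSpace ℝ (Fin d)))
    (σ ν : Measure (EuclideanSpace ℝ (Fin d))) : ℝ :=
  ⨆ f : {f : EuclideanSpace ℝ (Fin d) → ℝ // LipschitzWith 1 f ∧ Function.support f ⊆ B},
    |(∫ x, f.1 x ∂σ) - ∫ x, f.1 x ∂ν|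

/-- `dist_B(μ, F)`: distance from `μ` to the family of 1-flat measures. -/
noncomputable def distToFlat {d : ℕ} (B : Set (EuclideanSpace ℝ (Fin d)))
    (μ : Measure (EuclideanSpace ℝ (Fin d))) : ℝ :=
  ⨅ σ : {σ : Measure (EuclideanSpace ℝ (Fin d)) // IsFlat σ}, distB B μ σ.1


open Filter Topology
open scoped CompactlySupported
set_option linter.unusedSectionVars false


/-- A real sequence bounded along an ultrafilter converges along it. -/
lemma ultra_lim (U : Ultrafilter ℕ) (a : ℕ → ℝ) (M : ℝ) (h : ∀ᶠ k in (U : Filter ℕ), |a k| ≤ M) :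
    ∃ l, Tendsto a U (𝓝 l) := by
  have h1 : Set.Icc (-M) M ∈ U.map a := by
    rw [Ultrafilter.mem_map]
    filter_upwards [h] with k hk
    exact abs_le.mp hk
  obtain ⟨l, -, hl⟩ := isCompact_Icc.ultrafilter_le_nhds' (U.map a) h1
  exact ⟨l, hl⟩

section
variable {E : Type*} [NormedAddCommGroup E] [InnerProductSpace ℝ E] [FiniteDimensional ℝ E]
  [MeasurableSpace E] [BorelSpace E]

/-- Vague compactness along an ultrafilter. -/
lemma exists_vague_limit (U : Ultrafilter ℕ) (μ : ℕ → Measure E)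
    (hlf : ∀ k, IsLocallyFiniteMeasure (μ k))
    (hb : ∀ R : ℝ, ∃ C : ℝ, ∀ᶠ k in (U : Filter ℕ), (μ k) (closedBall 0 R) ≤ ENNReal.ofReal C) :
    ∃ ν : Measure E, IsLocallyFiniteMeasure ν ∧ ∀ f : E → ℝ, Continuous f → HasCompactSupport f →
      Tendsto (fun k => ∫ x, f x ∂(μ k)) U (𝓝 (∫ x, f x ∂ν)) := by
  have hex : ∀ f : C_c(E, ℝ), ∃ l, Tendsto (fun k => ∫ x, f x ∂(μ k)) U (𝓝 l) := by
    intro f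
    obtain ⟨M, hM⟩ := f.hasCompactSupport.exists_bound_of_continuous f.continuous
    obtain ⟨R, hR⟩ := f.hasCompactSupport.isCompact.isBounded.subset_closedBall (0 : E)
    obtain ⟨C, hC⟩ := hb R
    refine ultra_lim U _ (M * max C 0) ?_
    filter_upwards [hC] with k hk
    have h1 : ∫ x, f x ∂(μ k) = ∫ x in closedBall 0 R, f x ∂(μ k) := by
      rw [setIntegral_eq_integral_of_forall_compl_eq_zero]
      intro x hx
      by_contra h
      exact hx (hR (subset_tsupport _ h))
    rw [h1, ← Real.norm_eq_abs]
    have hM0 : 0 ≤ M := (norm_nonneg _).trans (hM 0)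
    refine (norm_setIntegral_le_of_norm_le_const (C := M) (hk.trans_lt ENNReal.ofReal_lt_top)
      (fun x _ => hM x)).trans ?_
    gcongr
    rw [Measure.real]
    refine (ENNReal.toReal_mono ENNReal.ofReal_ne_top hk).trans ?_
    rw [ENNReal.toReal_ofReal']
  choose L hL using hex
  have hintg : ∀ (f : C_c(E, ℝ)) k, Integrable (fun x => f x) (μ k) := fun f k =>
    f.continuous.integrable_of_hasCompactSupport f.hasCompactSupport
  let Λ0 : C_c(E, ℝ) →ₗ[ℝ] ℝ :=
    { toFun := L
      map_add' := by
        intro f g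
        refine tendsto_nhds_unique (hL (f + g)) ?_
        refine ((hL f).add (hL g)).congr fun k => ?_
        rw [← integral_add (hintg f k) (hintg g k)]
        rfl
      map_smul' := by
        intro c f
        refine tendsto_nhds_unique (hL (c • f)) ?_
        refine ((hL f).const_mul c).congr fun k => ?_
        rw [← integral_const_mul]
        rfl }
  let Λ : C_c(E, ℝ) →ₚ[ℝ] ℝ := PositiveLinearMap.mk₀ Λ0 (by
    intro f hf
    refine ge_of_tendsto' (hL f) fun k => ?_
    exact integral_nonneg fun x => hf x)
  refine ⟨RealRMK.rieszMeasure Λ, ?_, ?_⟩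
  · have : (RealRMK.rieszMeasure Λ).Regular := by infer_instance
    infer_instance
  · intro f hf hfc
    have := RealRMK.integral_rieszMeasure Λ ⟨⟨f, hf⟩, hfc⟩
    have h2 := hL ⟨⟨f, hf⟩, hfc⟩
    have e : Λ ⟨⟨f, hf⟩, hfc⟩ = L ⟨⟨f, hf⟩, hfc⟩ := rfl
    rw [← e, ← this] at h2
    exact h2

/-- cut-off function -/
noncomputable def cutoff (x : E) (a b : ℝ) (y : E) : ℝ := max 0 (min 1 ((b - dist y x) / (b - a)))

lemma cutoff_cont (x : E) (a b : ℝ) : Continuous (cutoff x a b) := by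
  unfold cutoff; fun_prop

lemma cutoff_nonneg (x : E) (a b : ℝ) (y : E) : 0 ≤ cutoff x a b y := le_max_left _ _

lemma cutoff_le_one (x : E) (a b : ℝ) (y : E) : cutoff x a b y ≤ 1 :=
  max_le zero_le_one (min_le_left _ _)

lemma cutoff_eq_one (x : E) {a b : ℝ} (hab : a < b) {y : E} (hy : y ∈ closedBall x a) :
    cutoff x a b y = 1 := by
  rw [mem_closedBall] at hy
  have : 1 ≤ (b - dist y x) / (b - a) := by rw [le_div_iff₀ (by linarith)]; linarith
  simp [cutoff, this]

lemma cutoff_eq_zero (x : E) {a b : ℝ} (hab : a < b) {y : E} (hy : y ∉ ball x b) :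
    cutoff x a b y = 0 := by
  rw [mem_ball, not_lt] at hy
  have : (b - dist y x) / (b - a) ≤ 0 := div_nonpos_of_nonpos_of_nonneg (by linarith) (by linarith)
  unfold cutoff
  apply max_eq_left
  exact (min_le_right _ _).trans this

lemma cutoff_compact (x : E) {a b : ℝ} (hab : a < b) : HasCompactSupport (cutoff x a b) := by
  refine HasCompactSupport.of_support_subset_isCompact (isCompact_closedBall x b) ?_
  intro y hy
  by_contra h
  exact hy (cutoff_eq_zero x hab (fun h' => h (ball_subset_closedBall h')))

lemma le_cutoff_integral (μ : Measure E) [IsLocallyFiniteMeasure μ] (x : E) {a b : ℝ} (hab : a < b) :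
    (μ (closedBall x a)).toReal ≤ ∫ y, cutoff x a b y ∂μ := by
  have hi : Integrable (cutoff x a b) μ :=
    (cutoff_cont x a b).integrable_of_hasCompactSupport (cutoff_compact x hab)
  have : (μ (closedBall x a)).toReal = ∫ y, (closedBall x a).indicator (fun _ => (1 : ℝ)) y ∂μ := by
    rw [integral_indicator_const _ measurableSet_closedBall]; simp [Measure.real]
  rw [this]
  refine integral_mono ?_ hi ?_
  · rw [integrable_indicator_iff measurableSet_closedBall]
    simp [integrableOn_const_iff, measure_closedBall_lt_top]
  · intro y
    by_cases h : y ∈ closedBall x a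
    · simp only [Set.indicator_of_mem h]; exact (cutoff_eq_one x hab h).ge
    · simp only [Set.indicator_of_notMem h]; exact cutoff_nonneg _ _ _ _

lemma cutoff_integral_le (μ : Measure E) [IsLocallyFiniteMeasure μ] (x : E) {a b : ℝ} (hab : a < b) :
    ∫ y, cutoff x a b y ∂μ ≤ (μ (ball x b)).toReal := by
  have hi : Integrable (cutoff x a b) μ :=
    (cutoff_cont x a b).integrable_of_hasCompactSupport (cutoff_compact x hab)
  have : (μ (ball x b)).toReal = ∫ y, (ball x b).indicator (fun _ => (1 : ℝ)) y ∂μ := by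
    rw [integral_indicator_const _ measurableSet_ball]; simp [Measure.real]
  rw [this]
  refine integral_mono hi ?_ ?_
  · rw [integrable_indicator_iff measurableSet_ball]
    simp [integrableOn_const_iff, measure_ball_lt_top]
  · intro y
    by_cases h : y ∈ ball x b
    · simp only [Set.indicator_of_mem h]; exact cutoff_le_one _ _ _ _
    · simp only [Set.indicator_of_notMem h]; exact (cutoff_eq_zero x hab h).le

/-- Convergence of integrals of equi-Lipschitz functions. -/
lemma tendsto_integral_lip (U : Ultrafilter ℕ) (μ : ℕ → Measure E)
    (hlf : ∀ k, IsLocallyFiniteMeasure (μ k)) (ν : Measure E)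
    (hν : ∀ f : E → ℝ, Continuous f → HasCompactSupport f →
      Tendsto (fun k => ∫ x, f x ∂(μ k)) U (𝓝 (∫ x, f x ∂ν)))
    (R C : ℝ) (hC : ∀ᶠ k in (U : Filter ℕ), (μ k) (closedBall 0 R) ≤ ENNReal.ofReal C)
    (f : ℕ → E → ℝ) (g : E → ℝ) (hf : ∀ k, LipschitzWith 1 (f k))
    (hs : ∀ k x, x ∉ closedBall (0 : E) R → f k x = 0)
    (hg : ∀ x, Tendsto (fun k => f k x) U (𝓝 (g x))) :
    Tendsto (fun k => ∫ x, f k x ∂(μ k)) U (𝓝 (∫ x, g x ∂ν)) := by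
  have hg1 : LipschitzWith 1 g := by
    refine LipschitzWith.of_dist_le_mul fun x y => ?_
    exact le_of_tendsto' ((hg x).dist (hg y)) fun k => (hf k).dist_le_mul x y
  have hgs : ∀ x, x ∉ closedBall (0 : E) R → g x = 0 := fun x hx =>
    tendsto_nhds_unique (hg x) (by simp [hs _ x hx])
  have hcs : ∀ φ : E → ℝ, (∀ x, x ∉ closedBall (0 : E) R → φ x = 0) → HasCompactSupport φ := by
    intro φ hφ
    refine HasCompactSupport.of_support_subset_isCompact (isCompact_closedBall 0 R) ?_
    intro y hy
    by_contra h
    exact hy (hφ y h)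
  have key : Tendsto (fun k => (∫ x, f k x ∂(μ k)) - ∫ x, g x ∂(μ k)) U (𝓝 0) := by
    rw [Metric.tendsto_nhds]
    intro ε hε
    set C' := max C 0 + 1
    have hC' : 0 < C' := by positivity
    set η := ε / (4 * C') with hη
    have hη0 : 0 < η := by positivity
    obtain ⟨t, -, htf, htc⟩ := (isCompact_closedBall (0 : E) R).finite_cover_balls hη0
    have hev : ∀ᶠ k in (U : Filter ℕ), ∀ x ∈ t, dist (f k x) (g x) < η := by
      rw [Filter.eventually_all_finite htf]
      intro x _
      exact (Metric.tendsto_nhds.mp (hg x)) η hη0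
    filter_upwards [hev, hC] with k hk hCk
    rw [← integral_sub ((hf k).continuous.integrable_of_hasCompactSupport (hcs _ (hs k)))
      (hg1.continuous.integrable_of_hasCompactSupport (hcs _ hgs))]
    rw [← setIntegral_eq_integral_of_forall_compl_eq_zero (s := closedBall (0:E) R)
      (fun x hx => by rw [hs k x hx, hgs x hx, sub_zero]), dist_zero_right]
    have hle : ‖∫ x in closedBall (0:E) R, (f k x - g x) ∂(μ k)‖ ≤
        (3 * η) * (μ k).real (closedBall 0 R) := by
      refine norm_setIntegral_le_of_norm_le_const (hCk.trans_lt ENNReal.ofReal_lt_top) ?_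
      intro x hx
      have := htc hx
      simp only [Set.mem_iUnion, exists_prop] at this
      obtain ⟨z, hz, hxz⟩ := this
      rw [mem_ball] at hxz
      have h1 := (hf k).dist_le_mul x z
      have h2 := hg1.dist_le_mul z x
      have h3 := hk z hz
      simp only [NNReal.coe_one, one_mul] at h1 h2
      rw [dist_comm z x] at h2
      rw [← dist_eq_norm]
      have := dist_triangle4 (f k x) (f k z) (g z) (g x)
      linarith
    have hm : (μ k).real (closedBall 0 R) ≤ C' := by
      rw [Measure.real]
      refine (ENNReal.toReal_mono ENNReal.ofReal_ne_top hCk).trans ?_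
      rw [ENNReal.toReal_ofReal']
      simp only [C']; linarith
    calc _ ≤ _ := hle
      _ ≤ 3 * η * C' := by gcongr
      _ < ε := by rw [hη]; field_simp; norm_num
  have h2 := hν g hg1.continuous (hcs _ hgs)
  have := key.add h2
  simpa using this
end


/-- Lower bound of the square function type integral. -/
lemma lowbd {d : ℕ} (μ : Measure (EuclideanSpace ℝ (Fin d))) (δ a b q m g : ℝ)
    (x0 : EuclideanSpace ℝ (Fin d)) (A : Set (EuclideanSpace ℝ (Fin d))) (hA : MeasurableSet A)
    (hδa : δ ≤ a) (hb : b ≤ δ⁻¹) (ha : 0 < a) (hab : a < b)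
    (hsub : A ⊆ ball 0 δ⁻¹) (hq : 0 ≤ q)
    (hm : ENNReal.ofReal m ≤ μ A)
    (h : ∀ r ∈ Set.Ioc a b, ∀ x ∈ A, q ≤ ballDelta μ x r) :
    ENNReal.ofReal (q * m / b * (b - a)) ≤ ∫⁻ r in Set.Ioc δ δ⁻¹,
          (∫⁻ x in ball (0 : EuclideanSpace ℝ (Fin d)) δ⁻¹,
            ENNReal.ofReal (ballDelta μ x r) ∂μ) / ENNReal.ofReal r := by
  have hb0 : 0 < b := ha.trans hab
  calc ENNReal.ofReal (q * m / b * (b - a))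
      = ∫⁻ r in Set.Ioc a b, ENNReal.ofReal (q * m / b) := by
        rw [setLIntegral_const, Real.volume_Ioc, ENNReal.ofReal_mul' (by linarith)]
    _ ≤ ∫⁻ r in Set.Ioc a b, (∫⁻ x in ball (0 : EuclideanSpace ℝ (Fin d)) δ⁻¹,
            ENNReal.ofReal (ballDelta μ x r) ∂μ) / ENNReal.ofReal r := by
        refine setLIntegral_mono' measurableSet_Ioc fun r hr => ?_
        rw [ENNReal.ofReal_div_of_pos hb0]
        refine ENNReal.div_le_div ?_ (ENNReal.ofReal_le_ofReal hr.2)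
        calc ENNReal.ofReal (q * m) = ENNReal.ofReal q * ENNReal.ofReal m := ENNReal.ofReal_mul hq
          _ ≤ ENNReal.ofReal q * μ A := by gcongr
          _ = ∫⁻ x in A, ENNReal.ofReal q ∂μ := by rw [setLIntegral_const]
          _ ≤ ∫⁻ x in A, ENNReal.ofReal (ballDelta μ x r) ∂μ :=
              setLIntegral_mono' hA fun x hx => ENNReal.ofReal_le_ofReal (h r hr x hx)
          _ ≤ _ := lintegral_mono_set hsub
    _ ≤ _ := lintegral_mono_set (Set.Ioc_subset_Ioc hδa hb)

lemma meas_ball {d : ℕ} (μ : Measure (EuclideanSpace ℝ (Fin d))) [IsLocallyFiniteMeasure μ] (r : ℝ) :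
    Measurable fun x => μ (ball x r) := by
  have hs : MeasurableSet {p : EuclideanSpace ℝ (Fin d) × EuclideanSpace ℝ (Fin d) |
      dist p.2 p.1 < r} := by
    apply IsOpen.measurableSet
    exact isOpen_lt (by fun_prop) (by fun_prop)
  exact measurable_measure_prodMk_left hs

lemma ball_delta_le {d : ℕ} (μ : Measure (EuclideanSpace ℝ (Fin d))) [IsLocallyFiniteMeasure μ]
    (x : EuclideanSpace ℝ (Fin d)) {r : ℝ} (hr : 0 < r) :
    μ (ball x (2 * r)) ≤ 2 * μ (ball x r) +
      ENNReal.ofReal (2 * r) * ENNReal.ofReal (ballDelta μ x r) := by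
  have h1 : μ (ball x (2 * r)) ≠ ∞ := measure_ball_lt_top.ne
  have h2 : μ (ball x r) ≠ ∞ := measure_ball_lt_top.ne
  rw [← ENNReal.ofReal_toReal h1, ← ENNReal.ofReal_mul (by positivity)]
  have e : 2 * μ (ball x r) = ENNReal.ofReal (2 * (μ (ball x r)).toReal) := by
    rw [ENNReal.ofReal_mul (by norm_num), ENNReal.ofReal_toReal h2]; simp
  have hbd : 0 ≤ ballDelta μ x r := abs_nonneg _
  rw [e, ← ENNReal.ofReal_add (by positivity) (mul_nonneg (by positivity) hbd)]
  apply ENNReal.ofReal_le_ofReal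
  unfold ballDelta
  have := neg_abs_le ((μ (ball x r)).toReal / r - (μ (ball x (2 * r))).toReal / (2 * r))
  set D := |(μ (ball x r)).toReal / r - (μ (ball x (2 * r))).toReal / (2 * r)|
  have h3 : (μ (ball x (2 * r))).toReal / (2 * r) ≤ (μ (ball x r)).toReal / r + D := by linarith
  rw [div_le_iff₀ (by positivity)] at h3
  have h4 : ((μ (ball x r)).toReal / r + D) * (2 * r) = 2 * (μ (ball x r)).toReal + 2 * r * D := by
    field_simp
  linarith

lemma growth_step {d : ℕ} (μ : Measure (EuclideanSpace ℝ (Fin d))) [IsLocallyFiniteMeasure μ]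
    (δ b : ℝ) (hδ : 0 < δ) (hδ1 : δ ≤ 1 / 2) (hb : 1 ≤ b) (hbδ : b ≤ δ⁻¹)
    (hI : (∫⁻ r in Set.Ioc δ δ⁻¹,
          (∫⁻ x in ball (0 : EuclideanSpace ℝ (Fin d)) δ⁻¹,
            ENNReal.ofReal (ballDelta μ x r) ∂μ) / ENNReal.ofReal r) ≤
        ENNReal.ofReal (Real.sqrt δ)) :
    ∫⁻ x in closedBall (0 : EuclideanSpace ℝ (Fin d)) 1, μ (ball x (4 / 3 * b)) ∂μ ≤
      2 * (∫⁻ x in closedBall (0 : EuclideanSpace ℝ (Fin d)) 1, μ (ball x b) ∂μ) +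
        ENNReal.ofReal (8 * b) := by
  set A := closedBall (0 : EuclideanSpace ℝ (Fin d)) 1
  have hsub : A ⊆ ball 0 δ⁻¹ := by
    apply closedBall_subset_ball
    rw [lt_inv_comm₀ (by norm_num) hδ]; linarith
  have hgood : ∃ r ∈ Set.Ioc (2 / 3 * b) b, ∫⁻ x in A, ENNReal.ofReal (ballDelta μ x r) ∂μ ≤ 4 := by
    by_contra hcon
    push Not at hcon
    have : ENNReal.ofReal (4 / 3) ≤ ENNReal.ofReal (Real.sqrt δ) := by
      refine le_trans ?_ hI
      calc ENNReal.ofReal (4 / 3) = ∫⁻ r in Set.Ioc (2 / 3 * b) b, ENNReal.ofReal (4 / b) := by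
            rw [setLIntegral_const, Real.volume_Ioc, ← ENNReal.ofReal_mul (by positivity)]
            congr 1; field_simp; norm_num
        _ ≤ ∫⁻ r in Set.Ioc (2 / 3 * b) b, (∫⁻ x in ball (0 : EuclideanSpace ℝ (Fin d)) δ⁻¹,
            ENNReal.ofReal (ballDelta μ x r) ∂μ) / ENNReal.ofReal r := by
            refine setLIntegral_mono' measurableSet_Ioc fun r hr => ?_
            rw [ENNReal.ofReal_div_of_pos (by linarith)]
            refine ENNReal.div_le_div ?_ (ENNReal.ofReal_le_ofReal hr.2)
            refine le_trans ?_ ((hcon r hr).le.trans (lintegral_mono_set hsub))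
            simp
        _ ≤ _ := lintegral_mono_set (Set.Ioc_subset_Ioc (by linarith) hbδ)
    rw [ENNReal.ofReal_le_ofReal_iff (Real.sqrt_nonneg _)] at this
    have h2 : Real.sqrt δ ≤ 1 := Real.sqrt_le_one.mpr (by linarith)
    linarith
  obtain ⟨r, hr, hr4⟩ := hgood
  have hr0 : 0 < r := by have := hr.1; linarith
  calc ∫⁻ x in A, μ (ball x (4 / 3 * b)) ∂μ
      ≤ ∫⁻ x in A, (2 * μ (ball x r) + ENNReal.ofReal (2 * r) * ENNReal.ofReal (ballDelta μ x r)) ∂μ := by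
        refine lintegral_mono fun x => ?_
        refine le_trans (measure_mono (ball_subset_ball ?_)) (ball_delta_le μ x hr0)
        have := hr.1; linarith
    _ = 2 * (∫⁻ x in A, μ (ball x r) ∂μ) +
          ENNReal.ofReal (2 * r) * ∫⁻ x in A, ENNReal.ofReal (ballDelta μ x r) ∂μ := by
        rw [lintegral_add_left ((meas_ball μ r).const_mul 2), lintegral_const_mul _ (meas_ball μ r),
          lintegral_const_mul' _ _ ENNReal.ofReal_ne_top]
    _ ≤ _ := by
        gcongr ?_ + ?_
        · gcongr
          exact hr.2
        · calc _ ≤ ENNReal.ofReal (2 * r) * 4 := by gcongr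
            _ = ENNReal.ofReal (2 * r * 4) := by
              rw [ENNReal.ofReal_mul (p := 2 * r) (by positivity)]; simp
            _ ≤ _ := ENNReal.ofReal_le_ofReal (by have := hr.2; linarith)

lemma growth_aux (d : ℕ) (n : ℕ) : ∃ K : ℝ≥0∞, K ≠ ∞ ∧ ∀ (μ : Measure (EuclideanSpace ℝ (Fin d)))
    (_ : IsLocallyFiniteMeasure μ)
    (δ : ℝ), 0 < δ → δ ≤ 1 / 2 → (4 / 3 : ℝ) ^ n ≤ δ⁻¹ →
    μ (ball (0 : EuclideanSpace ℝ (Fin d)) 2) ≤ 9 →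
    (∫⁻ r in Set.Ioc δ δ⁻¹,
          (∫⁻ x in ball (0 : EuclideanSpace ℝ (Fin d)) δ⁻¹,
            ENNReal.ofReal (ballDelta μ x r) ∂μ) / ENNReal.ofReal r) ≤
        ENNReal.ofReal (Real.sqrt δ) →
    ∫⁻ x in closedBall (0 : EuclideanSpace ℝ (Fin d)) 1, μ (ball x ((4 / 3) ^ n)) ∂μ ≤ K := by
  induction n with
  | zero =>
    refine ⟨9 * 9, by finiteness, ?_⟩
    intro μ _ δ hδ hδ1 _ h9 _
    calc _ ≤ ∫⁻ x in closedBall (0 : EuclideanSpace ℝ (Fin d)) 1, 9 ∂μ := by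
          refine setLIntegral_mono' measurableSet_closedBall fun x hx => ?_
          refine (measure_mono ?_).trans h9
          rw [mem_closedBall, dist_zero_right] at hx
          apply ball_subset_ball'
          rw [dist_zero_right]; simp; linarith
      _ = 9 * μ (closedBall 0 1) := by rw [setLIntegral_const]
      _ ≤ 9 * 9 := by
          gcongr
          exact (measure_mono (closedBall_subset_ball (by norm_num))).trans h9
  | succ n ih =>
    obtain ⟨K, hK, ih⟩ := ih
    refine ⟨2 * K + ENNReal.ofReal (8 * (4 / 3) ^ n), by finiteness, ?_⟩
    intro μ _ δ hδ hδ1 hn h9 hI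
    have hle : (4 / 3 : ℝ) ^ n ≤ (4 / 3) ^ (n + 1) :=
      pow_le_pow_right₀ (by norm_num) (Nat.le_succ n)
    have h1 := ih μ inferInstance δ hδ hδ1 (hle.trans hn) h9 hI
    have h2 := growth_step μ δ ((4 / 3) ^ n) hδ hδ1 (one_le_pow₀ (by norm_num)) (hle.trans hn) hI
    rw [pow_succ']
    refine h2.trans ?_
    gcongr

lemma growth (d : ℕ) (R : ℝ) : ∃ C : ℝ, ∃ δ0 > 0, ∀ (μ : Measure (EuclideanSpace ℝ (Fin d)))
    (_ : IsLocallyFiniteMeasure μ)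
    (δ : ℝ), 0 < δ → δ ≤ δ0 →
    1 ≤ μ (closedBall (0 : EuclideanSpace ℝ (Fin d)) 1) →
    μ (ball (0 : EuclideanSpace ℝ (Fin d)) 2) ≤ 9 →
    (∫⁻ r in Set.Ioc δ δ⁻¹,
          (∫⁻ x in ball (0 : EuclideanSpace ℝ (Fin d)) δ⁻¹,
            ENNReal.ofReal (ballDelta μ x r) ∂μ) / ENNReal.ofReal r) ≤
        ENNReal.ofReal (Real.sqrt δ) →
    μ (closedBall (0 : EuclideanSpace ℝ (Fin d)) R) ≤ ENNReal.ofReal C := by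
  obtain ⟨n, hn⟩ := pow_unbounded_of_one_lt (R + 1) (show (1 : ℝ) < 4 / 3 by norm_num)
  obtain ⟨K, hK, h⟩ := growth_aux d n
  refine ⟨K.toReal, min (1 / 2) ((4 / 3) ^ n)⁻¹, by positivity, ?_⟩
  intro μ _ δ hδ hδ0 h1 h9 hI
  rw [ENNReal.ofReal_toReal hK]
  have h2 := h μ inferInstance δ hδ (hδ0.trans (min_le_left _ _)) (by
    rw [le_inv_comm₀ (by positivity) hδ]; exact hδ0.trans (min_le_right _ _)) h9 hI
  refine le_trans ?_ h2
  calc μ (closedBall 0 R) = μ (closedBall 0 R) * 1 := by simp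
    _ ≤ μ (closedBall 0 R) * μ (closedBall 0 1) := by gcongr
    _ = ∫⁻ x in closedBall (0 : EuclideanSpace ℝ (Fin d)) 1, μ (closedBall 0 R) ∂μ := by
        rw [setLIntegral_const]
    _ ≤ _ := by
        refine setLIntegral_mono' measurableSet_closedBall fun x hx => measure_mono ?_
        intro y hy
        rw [mem_closedBall, dist_zero_right] at hx hy
        rw [mem_ball]
        have := dist_le_norm_add_norm y x
        linarith

section


lemma ev_gt {d : ℕ} (U : Ultrafilter ℕ) (μ : ℕ → Measure (EuclideanSpace ℝ (Fin d)))
    (hlf : ∀ k, IsLocallyFiniteMeasure (μ k)) (ν : Measure (EuclideanSpace ℝ (Fin d)))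
    [IsLocallyFiniteMeasure ν]
    (hν : ∀ f : EuclideanSpace ℝ (Fin d) → ℝ, Continuous f → HasCompactSupport f →
      Tendsto (fun k => ∫ x, f x ∂(μ k)) U (𝓝 (∫ x, f x ∂ν)))
    (x : EuclideanSpace ℝ (Fin d)) {a b M : ℝ} (hab : a < b)
    (h : M < (ν (ball x a)).toReal) : ∀ᶠ k in (U : Filter ℕ), M < (μ k (ball x b)).toReal := by
  have h1 := hν _ (cutoff_cont x a b) (cutoff_compact x hab)
  have h2 : (ν (ball x a)).toReal ≤ ∫ y, cutoff x a b y ∂ν :=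
    le_trans (ENNReal.toReal_mono measure_closedBall_lt_top.ne (measure_mono ball_subset_closedBall))
      (le_cutoff_integral ν x hab)
  filter_upwards [h1.eventually (lt_mem_nhds (h.trans_le h2))] with k hk
  exact hk.trans_le (cutoff_integral_le (μ k) x hab)

lemma ev_lt {d : ℕ} (U : Ultrafilter ℕ) (μ : ℕ → Measure (EuclideanSpace ℝ (Fin d)))
    (hlf : ∀ k, IsLocallyFiniteMeasure (μ k)) (ν : Measure (EuclideanSpace ℝ (Fin d)))
    [IsLocallyFiniteMeasure ν]
    (hν : ∀ f : EuclideanSpace ℝ (Fin d) → ℝ, Continuous f → HasCompactSupport f →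
      Tendsto (fun k => ∫ x, f x ∂(μ k)) U (𝓝 (∫ x, f x ∂ν)))
    (x : EuclideanSpace ℝ (Fin d)) {a b M : ℝ} (hab : a < b)
    (h : (ν (ball x b)).toReal < M) : ∀ᶠ k in (U : Filter ℕ), (μ k (ball x a)).toReal < M := by
  have h1 := hν _ (cutoff_cont x a b) (cutoff_compact x hab)
  have h2 := cutoff_integral_le ν x hab
  filter_upwards [h1.eventually (gt_mem_nhds (h2.trans_lt h))] with k hk
  refine lt_of_le_of_lt ?_ hk
  exact le_trans (ENNReal.toReal_mono measure_closedBall_lt_top.ne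
    (measure_mono ball_subset_closedBall)) (le_cutoff_integral (μ k) x hab)


/-- Points of the support of the limit: `Δ` cannot stay bounded below near them. -/
lemma no_lower {d : ℕ} (U : Ultrafilter ℕ) (μ : ℕ → Measure (EuclideanSpace ℝ (Fin d)))
    (hlf : ∀ k, IsLocallyFiniteMeasure (μ k)) (ν : Measure (EuclideanSpace ℝ (Fin d)))
    [IsLocallyFiniteMeasure ν]
    (hν : ∀ f : EuclideanSpace ℝ (Fin d) → ℝ, Continuous f → HasCompactSupport f →
      Tendsto (fun k => ∫ x, f x ∂(μ k)) U (𝓝 (∫ x, f x ∂ν)))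
    (δ : ℕ → ℝ) (hδ0 : ∀ k, 0 < δ k) (hδ : Tendsto δ U (𝓝 0))
  (hI : ∀ k, (∫⁻ r in Set.Ioc (δ k) (δ k)⁻¹,
          (∫⁻ x in ball (0 : EuclideanSpace ℝ (Fin d)) (δ k)⁻¹,
            ENNReal.ofReal (ballDelta (μ k) x r) ∂(μ k)) / ENNReal.ofReal r) ≤
        ENNReal.ofReal (Real.sqrt (δ k)))
    (x0 : EuclideanSpace ℝ (Fin d)) (hx0 : x0 ∈ ν.support) (a b g q : ℝ)
    (ha : 0 < a) (hab : a < b) (hg : 0 < g) (hq : 0 < q)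
    (h : ∀ᶠ k in (U : Filter ℕ), ∀ r ∈ Set.Ioc a b, ∀ x ∈ ball x0 g, q ≤ ballDelta (μ k) x r) :
    False := by
  have hpos : 0 < ν (ball x0 (g / 2)) :=
    (Measure.mem_support_iff_forall x0).mp hx0 _ (ball_mem_nhds _ (by positivity))
  set m := (ν (ball x0 (g / 2))).toReal / 2 with hm
  have hpos' : 0 < (ν (ball x0 (g / 2))).toReal := ENNReal.toReal_pos hpos.ne' measure_ball_lt_top.ne
  have hm0 : 0 < m := by positivity
  have hev := ev_gt U μ hlf ν hν x0 (a := g / 2) (b := g) (M := m) (by linarith) (by linarith)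
  have hb : 0 < b := ha.trans hab
  set c := q * m / b * (b - a) with hc
  have hc0 : 0 < c := by have : 0 < b - a := by linarith
                         positivity
  have hinv : Tendsto (fun k => (δ k)⁻¹) U atTop := by
    refine Filter.Tendsto.inv_tendsto_nhdsGT_zero ?_
    exact tendsto_nhdsWithin_iff.mpr ⟨hδ, Eventually.of_forall fun k => hδ0 k⟩
  have hsq : Tendsto (fun k => Real.sqrt (δ k)) U (𝓝 0) := by
    have := (Real.continuous_sqrt.tendsto 0).comp hδ
    simpa [Function.comp_def] using this
  have hall := h.and (hev.and ((hδ.eventually (gt_mem_nhds ha)).and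
    ((hinv.eventually_ge_atTop b).and ((hinv.eventually_ge_atTop (‖x0‖ + g)).and
      (hsq.eventually (gt_mem_nhds hc0))))))
  obtain ⟨k, h1, h2, h3, h4, h5, h6⟩ := hall.exists
  have := lowbd (μ k) (δ k) a b q m g x0 (ball x0 g) measurableSet_ball h3.le h4 ha hab
    (by
      apply ball_subset_ball'
      rw [dist_zero_right]; linarith) hq.le
    (by
      rw [← ENNReal.ofReal_toReal (measure_ball_lt_top (μ := μ k) (x := x0) (r := g)).ne]
      exact ENNReal.ofReal_le_ofReal h2.le) h1
  have := this.trans (hI k)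
  rw [ENNReal.ofReal_le_ofReal_iff (Real.sqrt_nonneg _)] at this
  linarith

lemma limit_upper {d : ℕ} (U : Ultrafilter ℕ) (μ : ℕ → Measure (EuclideanSpace ℝ (Fin d)))
    (hlf : ∀ k, IsLocallyFiniteMeasure (μ k)) (ν : Measure (EuclideanSpace ℝ (Fin d)))
    [IsLocallyFiniteMeasure ν]
    (hν : ∀ f : EuclideanSpace ℝ (Fin d) → ℝ, Continuous f → HasCompactSupport f →
      Tendsto (fun k => ∫ x, f x ∂(μ k)) U (𝓝 (∫ x, f x ∂ν)))
    (δ : ℕ → ℝ) (hδ0 : ∀ k, 0 < δ k) (hδ : Tendsto δ U (𝓝 0))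
  (hI : ∀ k, (∫⁻ r in Set.Ioc (δ k) (δ k)⁻¹,
          (∫⁻ x in ball (0 : EuclideanSpace ℝ (Fin d)) (δ k)⁻¹,
            ENNReal.ofReal (ballDelta (μ k) x r) ∂(μ k)) / ENNReal.ofReal r) ≤
        ENNReal.ofReal (Real.sqrt (δ k)))
    (x0 : EuclideanSpace ℝ (Fin d)) (hx0 : x0 ∈ ν.support) (r1 r2 : ℝ)
    (h1 : 0 < r1) (h12 : r1 < r2) :
    (ν (ball x0 (2 * r1))).toReal ≤ 2 * (ν (ball x0 r2)).toReal := by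
  by_contra hcon
  push Not at hcon
  set N1 := (ν (ball x0 (2 * r1))).toReal
  set N2 := (ν (ball x0 r2)).toReal
  set c := (N1 - 2 * N2) / 4 with hc
  have hc0 : 0 < c := by rw [hc]; linarith
  set g := (r2 - r1) / 4 with hg
  have hg0 : 0 < g := by rw [hg]; linarith
  have e1 := ev_gt U μ hlf ν hν x0 (a := 2 * r1) (b := 2 * (r1 + g)) (M := N1 - c) (by linarith)
    (by linarith)
  have e2 := ev_lt U μ hlf ν hν x0 (a := r1 + 3 * g) (b := r2) (M := N2 + c) (by linarith)
    (by linarith)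
  refine no_lower U μ hlf ν hν δ hδ0 hδ hI x0 hx0 (r1 + 2 * g) (r1 + 5 / 2 * g) (g / 2)
    (c / (2 * r2)) (by linarith) (by linarith) (by linarith) (by
      have : 0 < r2 := by linarith
      positivity) ?_
  filter_upwards [e1, e2] with k hk1 hk2
  intro r hr x hx
  rw [mem_ball] at hx
  have hr0 : 0 < r := by have := hr.1; linarith
  have i1 : (μ k (ball x0 (2 * (r1 + g)))).toReal ≤ (μ k (ball x (2 * r))).toReal := by
    refine ENNReal.toReal_mono measure_ball_lt_top.ne (measure_mono (ball_subset_ball' ?_))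
    rw [dist_comm]; have := hr.1; linarith
  have i2 : (μ k (ball x r)).toReal ≤ (μ k (ball x0 (r1 + 3 * g))).toReal := by
    refine ENNReal.toReal_mono measure_ball_lt_top.ne (measure_mono (ball_subset_ball' ?_))
    have := hr.2; linarith
  have hr2 : r ≤ r2 := by have := hr.2; linarith
  calc c / (2 * r2) ≤ c / (2 * r) := by gcongr
    _ ≤ ((μ k (ball x (2 * r))).toReal - 2 * (μ k (ball x r)).toReal) / (2 * r) := by
        gcongr; linarith
    _ = -((μ k (ball x r)).toReal / r - (μ k (ball x (2 * r))).toReal / (2 * r)) := by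
        field_simp; ring
    _ ≤ _ := neg_le_abs _

lemma limit_lower {d : ℕ} (U : Ultrafilter ℕ) (μ : ℕ → Measure (EuclideanSpace ℝ (Fin d)))
    (hlf : ∀ k, IsLocallyFiniteMeasure (μ k)) (ν : Measure (EuclideanSpace ℝ (Fin d)))
    [IsLocallyFiniteMeasure ν]
    (hν : ∀ f : EuclideanSpace ℝ (Fin d) → ℝ, Continuous f → HasCompactSupport f →
      Tendsto (fun k => ∫ x, f x ∂(μ k)) U (𝓝 (∫ x, f x ∂ν)))
    (δ : ℕ → ℝ) (hδ0 : ∀ k, 0 < δ k) (hδ : Tendsto δ U (𝓝 0))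
  (hI : ∀ k, (∫⁻ r in Set.Ioc (δ k) (δ k)⁻¹,
          (∫⁻ x in ball (0 : EuclideanSpace ℝ (Fin d)) (δ k)⁻¹,
            ENNReal.ofReal (ballDelta (μ k) x r) ∂(μ k)) / ENNReal.ofReal r) ≤
        ENNReal.ofReal (Real.sqrt (δ k)))
    (x0 : EuclideanSpace ℝ (Fin d)) (hx0 : x0 ∈ ν.support) (r1 r2 : ℝ)
    (h1 : 0 < r1) (h12 : r1 < r2) :
    2 * (ν (ball x0 r1)).toReal ≤ (ν (ball x0 (2 * r2))).toReal := by
  by_contra hcon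
  push Not at hcon
  set N1 := (ν (ball x0 r1)).toReal
  set N2 := (ν (ball x0 (2 * r2))).toReal
  set c := (2 * N1 - N2) / 4 with hc
  have hc0 : 0 < c := by rw [hc]; linarith
  set g := (r2 - r1) / 4 with hg
  have hg0 : 0 < g := by rw [hg]; linarith
  have e1 := ev_gt U μ hlf ν hν x0 (a := r1) (b := r1 + g) (M := N1 - c) (by linarith)
    (by linarith)
  have e2 := ev_lt U μ hlf ν hν x0 (a := 2 * (r1 + 3 * g)) (b := 2 * r2) (M := N2 + c) (by linarith)
    (by linarith)
  refine no_lower U μ hlf ν hν δ hδ0 hδ hI x0 hx0 (r1 + 2 * g) (r1 + 5 / 2 * g) (g / 2)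
    (c / (2 * r2)) (by linarith) (by linarith) (by linarith) (by
      have : 0 < r2 := by linarith
      positivity) ?_
  filter_upwards [e1, e2] with k hk1 hk2
  intro r hr x hx
  rw [mem_ball] at hx
  have hr0 : 0 < r := by have := hr.1; linarith
  have i1 : (μ k (ball x0 (r1 + g))).toReal ≤ (μ k (ball x r)).toReal := by
    refine ENNReal.toReal_mono measure_ball_lt_top.ne (measure_mono (ball_subset_ball' ?_))
    rw [dist_comm]; have := hr.1; linarith
  have i2 : (μ k (ball x (2 * r))).toReal ≤ (μ k (ball x0 (2 * (r1 + 3 * g)))).toReal := by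
    refine ENNReal.toReal_mono measure_ball_lt_top.ne (measure_mono (ball_subset_ball' ?_))
    have := hr.2; linarith
  have hr2 : r ≤ r2 := by have := hr.2; linarith
  calc c / (2 * r2) ≤ c / (2 * r) := by gcongr
    _ ≤ (2 * (μ k (ball x r)).toReal - (μ k (ball x (2 * r))).toReal) / (2 * r) := by
        gcongr; linarith
    _ = ((μ k (ball x r)).toReal / r - (μ k (ball x (2 * r))).toReal / (2 * r)) := by
        field_simp
    _ ≤ _ := le_abs_self _
end


section UDsec
variable {E : Type*} [NormedAddCommGroup E] [InnerProductSpace ℝ E] [FiniteDimensional ℝ E]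
  [MeasurableSpace E] [BorelSpace E]

/-- uniformly distributed measure with a doubling radial profile -/
structure UD (μ : Measure E) (S : Set E) (h : ℝ → ℝ) : Prop where
  closed : IsClosed S
  ne : S.Nonempty
  null : μ Sᶜ = 0
  ball : ∀ x ∈ S, ∀ r > 0, μ (ball x r) = ENNReal.ofReal (h r)
  pos : ∀ r > 0, 0 < h r
  dbl : ∀ r > 0, h (2 * r) = 2 * h r

variable {μ : Measure E} {S : Set E} {h : ℝ → ℝ}

lemma UD.mono (H : UD μ S h) {a b : ℝ} (ha : 0 < a) (hab : a ≤ b) : h a ≤ h b := by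
  obtain ⟨x, hx⟩ := H.ne
  have := measure_mono (μ := μ) (ball_subset_ball (x := x) hab)
  rw [H.ball x hx a ha, H.ball x hx b (ha.trans_le hab)] at this
  exact (ENNReal.ofReal_le_ofReal_iff (H.pos b (ha.trans_le hab)).le).mp this

lemma UD.pow (H : UD μ S h) (k : ℕ) {r : ℝ} (hr : 0 < r) : h (2 ^ k * r) = 2 ^ k * h r := by
  induction k with
  | zero => simp
  | succ n ih => rw [pow_succ', mul_assoc, H.dbl _ (by positivity), ih]; ring

lemma UD.finite_ball (H : UD μ S h) (x : E) (r : ℝ) : μ (Metric.ball x r) < ∞ := by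
  obtain ⟨p, hp⟩ := H.ne
  have : Metric.ball x r ⊆ Metric.ball p (|r| + dist x p + 1) := by
    apply ball_subset_ball'
    have := le_abs_self r
    linarith
  refine (measure_mono this).trans_lt ?_
  rw [H.ball p hp _ (by positivity)]
  exact ENNReal.ofReal_lt_top

lemma UD.lf (H : UD μ S h) : IsLocallyFiniteMeasure μ :=
  ⟨fun x => ⟨Metric.ball x 1, ball_mem_nhds _ one_pos, H.finite_ball x 1⟩⟩

/-- blow-down of `μ` -/
noncomputable def Mk (μ : Measure E) (k : ℕ) : Measure E :=
  ENNReal.ofReal ((1 / 2 : ℝ) ^ k) • μ.map (fun y => ((1 / 2 : ℝ) ^ k) • y)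

lemma ext_Iio {a b : Measure ℝ} (hf : ∀ r, a (Set.Iio r) ≠ ∞)
    (hab : ∀ r, a (Set.Iio r) = b (Set.Iio r)) : a = b := by
  have hf' : ∀ r, b (Set.Iio r) ≠ ∞ := fun r => hab r ▸ hf r
  apply Measure.ext_of_Ico' a b
  · intro x y hxy
    exact measure_ne_top_of_subset Set.Ico_subset_Iio_self (hf y)
  · intro x y hxy
    have e : Set.Ico x y = Set.Iio y \ Set.Iio x := by
      ext z; simp [and_comm]
    rw [e, measure_diff (Set.Iio_subset_Iio hxy.le) measurableSet_Iio.nullMeasurableSet (hf x),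
      measure_diff (Set.Iio_subset_Iio hxy.le) measurableSet_Iio.nullMeasurableSet (hf' x), hab, hab]

lemma UD.Mk_map_apply (H : UD μ S h) (k : ℕ) {x : E} (hx : x ∈ S) (r : ℝ) :
    (Mk μ k).map (fun z => ‖z - ((1 / 2 : ℝ) ^ k) • x‖) (Set.Iio r) =
      if 0 < r then ENNReal.ofReal (h r) else 0 := by
  set t := ((1 / 2 : ℝ) ^ k) with ht
  have ht0 : 0 < t := by positivity
  rw [Measure.map_apply (by fun_prop) measurableSet_Iio, Mk, Measure.smul_apply,
    Measure.map_apply (by fun_prop) (measurableSet_Iio.preimage (by fun_prop))]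
  have e : (fun y : E => ((1 / 2 : ℝ) ^ k) • y) ⁻¹' ((fun z => ‖z - t • x‖) ⁻¹' Set.Iio r) =
      Metric.ball x (r / t) := by
    ext y
    simp only [Set.mem_preimage, Set.mem_Iio, mem_ball, dist_eq_norm, ← ht]
    rw [← smul_sub, norm_smul, Real.norm_of_nonneg ht0.le, lt_div_iff₀ ht0, mul_comm]
  rw [e]
  split_ifs with hr
  · rw [H.ball x hx _ (by positivity), smul_eq_mul, ← ENNReal.ofReal_mul ht0.le]
    congr 1
    have := H.pow k hr
    rw [show r / t = 2 ^ k * r by rw [ht]; field_simp; ring_nf; simp [← mul_pow], this, ht, ← mul_assoc, ← mul_pow]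
    norm_num
  · rw [ball_eq_empty.mpr (by apply div_nonpos_of_nonpos_of_nonneg <;> linarith)]
    simp

lemma UD.map_norm (H : UD μ S h) (h0 : (0 : E) ∈ S) (r : ℝ) :
    μ.map (fun z => ‖z‖) (Set.Iio r) = if 0 < r then ENNReal.ofReal (h r) else 0 := by
  have := H.Mk_map_apply 0 h0 r
  simpa [Mk] using this

lemma UD.Mk_map (H : UD μ S h) (h0 : (0 : E) ∈ S) (k : ℕ) {x : E} (hx : x ∈ S) :
    (Mk μ k).map (fun z => ‖z - ((1 / 2 : ℝ) ^ k) • x‖) = μ.map (fun z => ‖z‖) := by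
  apply ext_Iio
  · intro r; rw [H.Mk_map_apply k hx]; split_ifs <;> simp
  · intro r; rw [H.Mk_map_apply k hx, H.map_norm h0]

lemma UD.integral_radial (H : UD μ S h) (h0 : (0 : E) ∈ S) (k : ℕ) {x : E} (hx : x ∈ S)
    (g : ℝ → ℝ) (hg : Continuous g) :
    ∫ z, g ‖z - ((1 / 2 : ℝ) ^ k) • x‖ ∂(Mk μ k) = ∫ z, g ‖z‖ ∂μ := by
  have h1 := integral_map (μ := Mk μ k) (φ := fun z => ‖z - ((1 / 2 : ℝ) ^ k) • x‖) (f := g)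
    (by fun_prop) hg.aestronglyMeasurable
  have h2 := integral_map (μ := μ) (φ := fun z : E => ‖z‖) (f := g)
    (by fun_prop) hg.aestronglyMeasurable
  rw [← h1, ← h2, H.Mk_map h0 k hx]

lemma UD.integral_norm (H : UD μ S h) (h0 : (0 : E) ∈ S) (k : ℕ)
    (g : ℝ → ℝ) (hg : Continuous g) :
    ∫ z, g ‖z‖ ∂(Mk μ k) = ∫ z, g ‖z‖ ∂μ := by
  have := H.integral_radial h0 k h0 g hg
  simpa using this

lemma UD.integrable_norm (H : UD μ S h) (h0 : (0 : E) ∈ S) (k : ℕ)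
    (g : ℝ → ℝ) (hg : Continuous g) :
    Integrable (fun z => g ‖z‖) (Mk μ k) ↔ Integrable (fun z => g ‖z‖) μ := by
  have h1 := integrable_map_measure (μ := Mk μ k) (f := fun z => ‖z‖) (g := g)
    hg.aestronglyMeasurable (by fun_prop)
  have h2 := integrable_map_measure (μ := μ) (f := fun z : E => ‖z‖) (g := g)
     hg.aestronglyMeasurable (by fun_prop)
  have h3 := H.Mk_map h0 k h0
  simp only [smul_zero, sub_zero] at h3
  rw [h3] at h1
  exact h1.symm.trans h2

lemma UD.integrable_exp (H : UD μ S h) (h0 : (0 : E) ∈ S) :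
    Integrable (fun z : E => Real.exp (-‖z‖)) μ := by
  refine ⟨by fun_prop, ?_⟩
  rw [hasFiniteIntegral_iff_ofReal (ae_of_all _ fun _ => (Real.exp_pos _).le)]
  have key : ∀ z : E, ENNReal.ofReal (Real.exp (-‖z‖)) ≤
      ∑' n : ℕ, (Metric.ball (0 : E) (n + 1)).indicator (fun _ => ENNReal.ofReal (Real.exp (-n))) z := by
    intro z
    refine le_trans ?_ (ENNReal.le_tsum ⌊‖z‖⌋₊)
    rw [Set.indicator_of_mem (by simpa using Nat.lt_floor_add_one ‖z‖)]
    apply ENNReal.ofReal_le_ofReal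
    apply Real.exp_le_exp.mpr
    have := Nat.floor_le (norm_nonneg z)
    linarith
  refine (lintegral_mono key).trans_lt ?_
  rw [lintegral_tsum fun n => (measurable_const.indicator measurableSet_ball).aemeasurable]
  have e : ∀ n : ℕ, ∫⁻ z, (Metric.ball (0 : E) (n + 1)).indicator
      (fun _ => ENNReal.ofReal (Real.exp (-n))) z ∂μ ≤
      ENNReal.ofReal (h 1 * (2 * Real.exp (-1)) ^ n) := by
    intro n
    rw [lintegral_indicator measurableSet_ball, setLIntegral_const, H.ball 0 h0 _ (by positivity),
      ← ENNReal.ofReal_mul (by positivity)]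
    apply ENNReal.ofReal_le_ofReal
    have h1 : h (n + 1) ≤ 2 ^ n * h 1 := by
      rw [← H.pow n one_pos]
      apply H.mono (by positivity)
      rw [mul_one]
      have : n + 1 ≤ 2 ^ n := Nat.lt_two_pow_self
      exact_mod_cast this
    calc Real.exp (-n) * h (n + 1) ≤ Real.exp (-n) * (2 ^ n * h 1) := by gcongr
      _ = _ := by
        rw [mul_pow, ← Real.exp_nat_mul]
        ring_nf
  refine (ENNReal.tsum_le_tsum e).trans_lt ?_
  have hs : Summable fun n : ℕ => h 1 * (2 * Real.exp (-1)) ^ n := by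
    apply Summable.mul_left
    apply summable_geometric_of_lt_one (by positivity)
    have := Real.exp_one_gt_d9
    rw [Real.exp_neg, ← div_eq_mul_inv, div_lt_one (Real.exp_pos 1)]
    linarith
  have hp := (H.pos 1 one_pos).le
  rw [← ENNReal.ofReal_tsum_of_nonneg (fun n => by positivity) hs]
  exact ENNReal.ofReal_lt_top

lemma UD.integrable_Mk (H : UD μ S h) (h0 : (0 : E) ∈ S) (k : ℕ) (f : E → ℝ) (hf : Continuous f)
    (C : ℝ) (hC : ∀ z, |f z| ≤ C * Real.exp (-‖z‖)) : Integrable f (Mk μ k) := by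
  have h1 := (H.integrable_norm h0 k (fun r => Real.exp (-r)) (by fun_prop)).mpr
    (H.integrable_exp h0)
  exact (h1.const_mul C).mono' hf.aestronglyMeasurable (ae_of_all _ hC)

end UDsec


section UDsec2
variable {E : Type*} [NormedAddCommGroup E] [InnerProductSpace ℝ E] [FiniteDimensional ℝ E]
  [MeasurableSpace E] [BorelSpace E]
variable {μ : Measure E} {S : Set E} {h : ℝ → ℝ}

lemma Mk_zero : Mk μ 0 = μ := by simp [Mk]

lemma gauss_bd (s A : ℝ) (hs : 0 < s) : ∃ C : ℝ, 0 ≤ C ∧ ∀ r : ℝ,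
    Real.exp (A * r) * Real.exp (-s * r ^ 2) ≤ C * Real.exp (-r) := by
  refine ⟨Real.exp ((A + 1) ^ 2 / (4 * s)), (Real.exp_pos _).le, fun r => ?_⟩
  rw [← Real.exp_add, ← Real.exp_add]
  apply Real.exp_le_exp.mpr
  have : (A + 1) ^ 2 / (4 * s) - (A + 1) * r + s * r ^ 2 = (A + 1 - 2 * s * r) ^ 2 / (4 * s) := by
    field_simp; ring
  have h2 : 0 ≤ (A + 1 - 2 * s * r) ^ 2 / (4 * s) := by positivity
  nlinarith

lemma UD.integrable_gauss (H : UD μ S h) (h0 : (0 : E) ∈ S) (k : ℕ) (s : ℝ) (hs : 0 < s)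
    (f : E → ℝ) (hf : Continuous f) (A B : ℝ) (hA : ∀ z, |f z| ≤ B * Real.exp (A * ‖z‖)) :
    Integrable (fun z => Real.exp (-s * ‖z‖ ^ 2) * f z) (Mk μ k) := by
  obtain ⟨C, hC0, hC⟩ := gauss_bd s A hs
  have hB : 0 ≤ B := by
    have := (abs_nonneg _).trans (hA 0)
    exact nonneg_of_mul_nonneg_left this (Real.exp_pos _)
  apply H.integrable_Mk h0 k _ (by fun_prop) (B * C)
  intro z
  rw [abs_mul, abs_of_pos (Real.exp_pos _)]
  calc _ ≤ Real.exp (-s * ‖z‖ ^ 2) * (B * Real.exp (A * ‖z‖)) := by gcongr; exact hA z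
    _ = B * (Real.exp (A * ‖z‖) * Real.exp (-s * ‖z‖ ^ 2)) := by ring
    _ ≤ B * (C * Real.exp (-‖z‖)) := mul_le_mul_of_nonneg_left (hC _) hB
    _ = _ := by ring

lemma UD.integrable_gauss0 (H : UD μ S h) (h0 : (0 : E) ∈ S) (s : ℝ) (hs : 0 < s) :
    Integrable (fun z => Real.exp (-s * ‖z‖ ^ 2)) μ := by
  have := H.integrable_gauss h0 0 s hs (fun _ => 1) (by fun_prop) 0 1 (by simp)
  simpa [Mk_zero] using this

lemma sq_le_exp (r : ℝ) (hr : 0 ≤ r) : r ^ 2 ≤ 2 * Real.exp r := by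
  have := Real.pow_div_factorial_le_exp r hr 2
  norm_num [Nat.factorial] at this
  linarith

lemma UD.scale_gauss (H : UD μ S h) (h0 : (0 : E) ∈ S) (s : ℝ) :
    2 * ∫ z, Real.exp (-(4 * s) * ‖z‖ ^ 2) ∂μ = ∫ z, Real.exp (-s * ‖z‖ ^ 2) ∂μ := by
  have := H.integral_norm h0 1 (fun r => Real.exp (-(4 * s) * r ^ 2)) (by fun_prop)
  rw [← this, Mk, integral_smul_measure, integral_map (by fun_prop) (by fun_prop)]
  simp only [pow_one, norm_smul]
  rw [ENNReal.toReal_ofReal (by norm_num)]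
  have : ∀ x : E, -(4 * s) * (‖(1 / 2 : ℝ)‖ * ‖x‖) ^ 2 = -s * ‖x‖ ^ 2 := by
    intro x; norm_num; ring
  simp_rw [this]
  simp

lemma UD.exists_s (H : UD μ S h) (h0 : (0 : E) ∈ S) : ∃ s : ℝ, 0 < s ∧
    2 * s * ∫ z, Real.exp (-s * ‖z‖ ^ 2) * ‖z‖ ^ 2 ∂μ ≤ ∫ z, Real.exp (-s * ‖z‖ ^ 2) ∂μ := by
  set I : ℝ → ℝ := fun s => ∫ z, Real.exp (-s * ‖z‖ ^ 2) ∂μ with hI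
  have hcont : ContinuousOn I (Set.Icc 1 4) := by
    apply continuousOn_of_dominated (bound := fun z => Real.exp (-1 * ‖z‖ ^ 2))
    · intro s hs; fun_prop
    · intro s hs
      refine ae_of_all _ fun z => ?_
      rw [Real.norm_of_nonneg (Real.exp_pos _).le]
      apply Real.exp_le_exp.mpr
      nlinarith [hs.1, sq_nonneg ‖z‖]
    · exact H.integrable_gauss0 h0 1 one_pos
    · refine ae_of_all _ fun z => by fun_prop
  obtain ⟨s0, hs0, hmax⟩ := isCompact_Icc.exists_isMaxOn (f := fun s => Real.sqrt s * I s)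
    (Set.nonempty_Icc.mpr (by norm_num : (1 : ℝ) ≤ 4)) (by fun_prop)
  have hmax' : ∀ s, 1 / 4 ≤ s → s ≤ s0 → Real.sqrt s * I s ≤ Real.sqrt s0 * I s0 := by
    intro s h1 h2
    by_cases hs : 1 ≤ s
    · exact hmax ⟨hs, h2.trans hs0.2⟩
    · have h3 := hmax (a := 4 * s) ⟨by linarith, by linarith⟩
      simp only [Set.mem_ofPred_eq] at h3
      have h4 : 2 * I (4 * s) = I s := H.scale_gauss h0 s
      have h5 : Real.sqrt (4 * s) = 2 * Real.sqrt s := by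
        rw [Real.sqrt_mul (by norm_num)]
        congr 1
        rw [show (4 : ℝ) = 2 ^ 2 by norm_num]; simp
      rw [h5] at h3
      rw [← h4]; linarith
  have hs1 : 1 ≤ s0 := hs0.1
  refine ⟨s0, by linarith, ?_⟩
  set J := ∫ z, Real.exp (-s0 * ‖z‖ ^ 2) * ‖z‖ ^ 2 ∂μ with hJ
  have hJi : Integrable (fun z => Real.exp (-s0 * ‖z‖ ^ 2) * ‖z‖ ^ 2) μ := by
    have := H.integrable_gauss h0 0 s0 (by linarith) (fun z => ‖z‖ ^ 2) (by fun_prop) 1 2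
      (fun z => by rw [abs_of_nonneg (by positivity), one_mul]; exact sq_le_exp _ (norm_nonneg z))
    simpa [Mk_zero] using this
  have step : ∀ s, 1 / 4 ≤ s → s < s0 →
      Real.sqrt s * (Real.sqrt s0 + Real.sqrt s) * J ≤ I s0 := by
    intro s h1 h2
    have hsp : 0 < s := by linarith
    have h3 : I s0 + (s0 - s) * J ≤ I s := by
      rw [hI, hJ, ← integral_const_mul, ← integral_add (H.integrable_gauss0 h0 s0 (by linarith))
        (hJi.const_mul _)]
      apply integral_mono ((H.integrable_gauss0 h0 s0 (by linarith)).add (hJi.const_mul _))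
        (H.integrable_gauss0 h0 s hsp)
      intro z
      have := Real.add_one_le_exp ((s0 - s) * ‖z‖ ^ 2)
      have e : Real.exp (-s * ‖z‖ ^ 2) =
          Real.exp (-s0 * ‖z‖ ^ 2) * Real.exp ((s0 - s) * ‖z‖ ^ 2) := by
        rw [← Real.exp_add]; ring_nf
      simp only [Pi.add_apply]
      rw [e]
      have h5 := mul_le_mul_of_nonneg_left this (Real.exp_pos (-s0 * ‖z‖ ^ 2)).le
      linarith
    have h4 := hmax' s h1 h2.le
    have h6 : Real.sqrt s < Real.sqrt s0 := Real.sqrt_lt_sqrt hsp.le h2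
    have h7 := Real.sq_sqrt hsp.le
    have h8 := Real.sq_sqrt (by linarith : 0 ≤ s0)
    have h9 : 0 ≤ Real.sqrt s := Real.sqrt_nonneg s
    have h10 := mul_le_mul_of_nonneg_left h3 h9
    set a := Real.sqrt s
    set b := Real.sqrt s0
    have : (b - a) * (a * (b + a) * J) ≤ (b - a) * I s0 := by
      have : s0 - s = (b - a) * (b + a) := by rw [← h7, ← h8]; ring
      rw [this] at h10
      nlinarith
    exact le_of_mul_le_mul_left this (by linarith)
  have hlim : Tendsto (fun s => Real.sqrt s * (Real.sqrt s0 + Real.sqrt s) * J) (𝓝[<] s0)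
      (𝓝 (Real.sqrt s0 * (Real.sqrt s0 + Real.sqrt s0) * J)) := by
    apply Tendsto.mono_left _ nhdsWithin_le_nhds
    apply Continuous.tendsto
    fun_prop
  have hfin := le_of_tendsto hlim (b := I s0) (by
    have : Set.Ioo (1 / 4) s0 ∈ 𝓝[<] s0 := Ioo_mem_nhdsLT (by linarith)
    filter_upwards [this] with s hs
    exact step s hs.1.le hs.2)
  have h8 := Real.mul_self_sqrt (by linarith : 0 ≤ s0)
  calc 2 * s0 * J = Real.sqrt s0 * (Real.sqrt s0 + Real.sqrt s0) * J := by
        nth_rewrite 1 [← h8]; ring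
    _ ≤ _ := hfin

/-- pointwise Taylor bound -/
lemma taylor_pt (s t X : ℝ) (hs : 0 < s) (ht : 0 < t) (ht1 : t ≤ 1) (v z : E)
    (hX : 0 ≤ X) (hv : ‖v‖ ≤ t * X) :
    |Real.exp (s * (2 * inner ℝ v z - ‖v‖ ^ 2)) - 1 -
      s * (2 * inner ℝ v z - ‖v‖ ^ 2 + 2 * s * (inner ℝ v z) ^ 2)| ≤
    t ^ 3 * ((s * (2 * X * ‖z‖ + X ^ 2)) ^ 3 * Real.exp (s * (2 * X * ‖z‖ + X ^ 2)) +
      s ^ 2 * (2 * X ^ 3 * ‖z‖ + X ^ 4 / 2)) := by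
  set a := inner ℝ v z with ha
  set n := ‖v‖ with hn
  have hn0 : 0 ≤ n := norm_nonneg _
  have hz0 : 0 ≤ ‖z‖ := norm_nonneg _
  have hab : |a| ≤ n * ‖z‖ := abs_real_inner_le_norm v z
  set w := s * (2 * a - n ^ 2) with hw
  have hnX : n ^ 2 ≤ t * X ^ 2 := by
    calc n ^ 2 ≤ (t * X) ^ 2 := by gcongr
      _ = t * (t * X ^ 2) := by ring
      _ ≤ t * (1 * X ^ 2) := by gcongr
      _ = _ := by ring
  have haX : |a| ≤ t * X * ‖z‖ := hab.trans (by gcongr)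
  have hwb : |w| ≤ t * (s * (2 * X * ‖z‖ + X ^ 2)) := by
    rw [hw, abs_mul, abs_of_pos hs]
    have : |2 * a - n ^ 2| ≤ 2 * |a| + n ^ 2 := by
      calc _ ≤ |2 * a| + |n ^ 2| := abs_sub _ _
        _ = _ := by rw [abs_mul, abs_of_nonneg (sq_nonneg n)]; simp
    calc s * |2 * a - n ^ 2| ≤ s * (2 * (t * X * ‖z‖) + t * X ^ 2) := by gcongr; linarith
      _ = _ := by ring
  have hT : |Real.exp w - 1 - w - w ^ 2 / 2| ≤ |w| ^ 3 * Real.exp |w| := by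
    have := Complex.norm_exp_sub_sum_le_norm_mul_exp (w : ℂ) 3
    have e : Complex.exp w - ∑ m ∈ Finset.range 3, (w : ℂ) ^ m / (m.factorial : ℂ) =
        ((Real.exp w - 1 - w - w ^ 2 / 2 : ℝ) : ℂ) := by
      simp [Finset.sum_range_succ, Nat.factorial]
      ring
    rw [e, Complex.norm_real, Complex.norm_real] at this
    simpa using this
  set Y := s * (2 * X * ‖z‖ + X ^ 2) with hY
  have hY0 : 0 ≤ Y := by positivity
  have hT2 : |w| ^ 3 * Real.exp |w| ≤ t ^ 3 * (Y ^ 3 * Real.exp Y) := by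
    have : |w| ≤ Y := hwb.trans (by nlinarith)
    calc _ ≤ (t * Y) ^ 3 * Real.exp Y := by gcongr
      _ = _ := by ring
  have hR : |w ^ 2 / 2 - s * (2 * s * a ^ 2)| ≤ t ^ 3 * (s ^ 2 * (2 * X ^ 3 * ‖z‖ + X ^ 4 / 2)) := by
    have e : w ^ 2 / 2 - s * (2 * s * a ^ 2) = s ^ 2 * (n ^ 4 / 2 - 2 * a * n ^ 2) := by
      rw [hw]; ring
    rw [e, abs_mul, abs_of_nonneg (sq_nonneg s)]
    have h1 : |n ^ 4 / 2 - 2 * a * n ^ 2| ≤ n ^ 4 / 2 + 2 * |a| * n ^ 2 := by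
      calc _ ≤ |n ^ 4 / 2| + |2 * a * n ^ 2| := abs_sub _ _
        _ = _ := by rw [abs_of_nonneg (by positivity), abs_mul, abs_mul, abs_of_nonneg (sq_nonneg n)]; simp
    have h2 : n ^ 4 ≤ t ^ 3 * X ^ 4 := by
      calc n ^ 4 ≤ (t * X) ^ 4 := by gcongr
        _ = t * (t ^ 3 * X ^ 4) := by ring
        _ ≤ 1 * (t ^ 3 * X ^ 4) := by gcongr
        _ = _ := by ring
    have h3 : |a| * n ^ 2 ≤ t ^ 3 * X ^ 3 * ‖z‖ := by
      calc |a| * n ^ 2 ≤ (t * X * ‖z‖) * (t * X) ^ 2 := by gcongr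
        _ = _ := by ring
    calc s ^ 2 * |n ^ 4 / 2 - 2 * a * n ^ 2| ≤ s ^ 2 * (t ^ 3 * X ^ 4 / 2 + 2 * (t ^ 3 * X ^ 3 * ‖z‖)) := by
          gcongr; linarith
      _ = _ := by ring
  have e : Real.exp w - 1 - s * (2 * a - n ^ 2 + 2 * s * a ^ 2) =
      (Real.exp w - 1 - w - w ^ 2 / 2) + (w ^ 2 / 2 - s * (2 * s * a ^ 2)) := by
    rw [hw]; ring
  rw [e]
  calc _ ≤ _ := abs_add_le _ _
    _ ≤ t ^ 3 * (Y ^ 3 * Real.exp Y) + t ^ 3 * (s ^ 2 * (2 * X ^ 3 * ‖z‖ + X ^ 4 / 2)) := by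
      linarith
    _ = _ := by ring

end UDsec2


section UDsec3
variable {E : Type*} [NormedAddCommGroup E] [InnerProductSpace ℝ E] [FiniteDimensional ℝ E]
  [MeasurableSpace E] [BorelSpace E]
variable {μ : Measure E} {S : Set E} {h : ℝ → ℝ}

lemma UD.int_lin (H : UD μ S h) (h0 : (0 : E) ∈ S) (s : ℝ) (hs : 0 < s) (k : ℕ) (x : E) :
    Integrable (fun z => Real.exp (-s * ‖z‖ ^ 2) * inner ℝ x z) (Mk μ k) := by
  apply H.integrable_gauss h0 k s hs _ (by fun_prop) 1 ‖x‖
  intro z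
  refine (abs_real_inner_le_norm x z).trans ?_
  gcongr
  have := Real.add_one_le_exp (1 * ‖z‖)
  linarith

lemma UD.int_sq (H : UD μ S h) (h0 : (0 : E) ∈ S) (s : ℝ) (hs : 0 < s) (k : ℕ) (x : E) :
    Integrable (fun z => Real.exp (-s * ‖z‖ ^ 2) * (inner ℝ x z) ^ 2) (Mk μ k) := by
  apply H.integrable_gauss h0 k s hs _ (by fun_prop) 1 (‖x‖ ^ 2 * 2)
  intro z
  rw [abs_pow]
  calc |inner ℝ x z| ^ 2 ≤ (‖x‖ * ‖z‖) ^ 2 := by gcongr; exact abs_real_inner_le_norm x z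
    _ = ‖x‖ ^ 2 * ‖z‖ ^ 2 := by ring
    _ ≤ ‖x‖ ^ 2 * (2 * Real.exp ‖z‖) := by gcongr; exact sq_le_exp _ (norm_nonneg z)
    _ = _ := by ring_nf

lemma UD.int_one (H : UD μ S h) (h0 : (0 : E) ∈ S) (s : ℝ) (hs : 0 < s) (k : ℕ) :
    Integrable (fun z => Real.exp (-s * ‖z‖ ^ 2)) (Mk μ k) := by
  have := H.integrable_gauss h0 k s hs (fun _ => 1) (by fun_prop) 0 1 (by simp)
  simpa using this

lemma UD.int_nsq (H : UD μ S h) (h0 : (0 : E) ∈ S) (s : ℝ) (hs : 0 < s) (k : ℕ) :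
    Integrable (fun z => Real.exp (-s * ‖z‖ ^ 2) * ‖z‖ ^ 2) (Mk μ k) := by
  apply H.integrable_gauss h0 k s hs (fun z => ‖z‖ ^ 2) (by fun_prop) 1 2
    (fun z => by rw [abs_of_nonneg (by positivity), one_mul]; exact sq_le_exp _ (norm_nonneg z))

lemma UD.int_norm (H : UD μ S h) (h0 : (0 : E) ∈ S) (s : ℝ) (hs : 0 < s) (k : ℕ) :
    Integrable (fun z => Real.exp (-s * ‖z‖ ^ 2) * ‖z‖) (Mk μ k) := by
  apply H.integrable_gauss h0 k s hs (fun z => ‖z‖) (by fun_prop) 1 1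
    (fun z => by
      rw [abs_of_nonneg (by positivity), one_mul, one_mul]
      have := Real.add_one_le_exp ‖z‖
      linarith)

lemma UD.taylor_int (H : UD μ S h) (h0 : (0 : E) ∈ S) (s : ℝ) (hs : 0 < s) {x : E} (hx : x ∈ S) :
    ∃ C : ℝ, ∀ k : ℕ,
      |2 * 2 ^ k * (∫ z, Real.exp (-s * ‖z‖ ^ 2) * inner ℝ x z ∂(Mk μ k))
        - ‖x‖ ^ 2 * (∫ z, Real.exp (-s * ‖z‖ ^ 2) ∂μ)
        + 2 * s * ∫ z, Real.exp (-s * ‖z‖ ^ 2) * (inner ℝ x z) ^ 2 ∂(Mk μ k)| ≤ C * (1 / 2) ^ k := by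
  set X := ‖x‖ with hX
  have hX0 : 0 ≤ X := norm_nonneg x
  set R : ℝ → ℝ := fun r => (s * (2 * X * r + X ^ 2)) ^ 3 * Real.exp (s * (2 * X * r + X ^ 2)) +
      s ^ 2 * (2 * X ^ 3 * r + X ^ 4 / 2) with hR
  have hRc : Continuous R := by fun_prop
  have hRi : ∀ k, Integrable (fun z => Real.exp (-s * ‖z‖ ^ 2) * R ‖z‖) (Mk μ k) := by
    intro k
    have i1 := H.integrable_gauss h0 k s hs (fun z => (s * (2 * X * ‖z‖ + X ^ 2)) ^ 3 *
      Real.exp (s * (2 * X * ‖z‖ + X ^ 2))) (by fun_prop) (4 * s * X) (6 * Real.exp (2 * s * X ^ 2))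
      (by
        intro z
        rw [abs_of_nonneg (by positivity)]
        set Y := s * (2 * X * ‖z‖ + X ^ 2) with hY
        have hY0 : 0 ≤ Y := by positivity
        have h3 : Y ^ 3 ≤ 6 * Real.exp Y := by
          have := Real.pow_div_factorial_le_exp Y hY0 3
          norm_num [Nat.factorial] at this
          linarith
        calc Y ^ 3 * Real.exp Y ≤ 6 * Real.exp Y * Real.exp Y := by gcongr
          _ = 6 * Real.exp (2 * s * X ^ 2) * Real.exp (4 * s * X * ‖z‖) := by
            rw [mul_assoc, mul_assoc, ← Real.exp_add, ← Real.exp_add, hY]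
            ring_nf)
    have i2 := H.integrable_gauss h0 k s hs (fun z => s ^ 2 * (2 * X ^ 3 * ‖z‖ + X ^ 4 / 2))
      (by fun_prop) 1 (s ^ 2 * (2 * X ^ 3 + X ^ 4 / 2))
      (by
        intro z
        rw [abs_of_nonneg (by positivity), one_mul]
        have h1 := Real.add_one_le_exp ‖z‖
        have h2 : 1 ≤ Real.exp ‖z‖ := Real.one_le_exp (norm_nonneg z)
        have h3 : ‖z‖ ≤ Real.exp ‖z‖ := by linarith
        calc s ^ 2 * (2 * X ^ 3 * ‖z‖ + X ^ 4 / 2 )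
            ≤ s ^ 2 * (2 * X ^ 3 * Real.exp ‖z‖ + X ^ 4 / 2 * Real.exp ‖z‖) := by
              have : X ^ 4 / 2 ≤ X ^ 4 / 2 * Real.exp ‖z‖ := le_mul_of_one_le_right (by positivity) h2
              gcongr
          _ = _ := by ring)
    have := i1.add i2
    refine this.congr (ae_of_all _ fun z => ?_)
    simp only [Pi.add_apply, hR]
    ring
  set CR := ∫ z, Real.exp (-s * ‖z‖ ^ 2) * R ‖z‖ ∂μ with hCR
  refine ⟨CR / s, fun k => ?_⟩
  set t : ℝ := (1 / 2) ^ k with ht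
  have ht0 : 0 < t := by positivity
  have ht1 : t ≤ 1 := pow_le_one₀ (by norm_num) (by norm_num)
  have ht2 : (2 : ℝ) ^ k * t = 1 := by rw [ht, ← mul_pow]; norm_num
  set I := ∫ z, Real.exp (-s * ‖z‖ ^ 2) ∂μ with hI
  set A := ∫ z, Real.exp (-s * ‖z‖ ^ 2) * inner ℝ x z ∂(Mk μ k) with hA
  set Q := ∫ z, Real.exp (-s * ‖z‖ ^ 2) * (inner ℝ x z) ^ 2 ∂(Mk μ k) with hQ
  have hI1 : ∫ z, Real.exp (-s * ‖z‖ ^ 2) ∂(Mk μ k) = I :=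
    H.integral_norm h0 k (fun r => Real.exp (-s * r ^ 2)) (by fun_prop)
  have hI2 : ∫ z, Real.exp (-s * ‖z - t • x‖ ^ 2) ∂(Mk μ k) = I :=
    H.integral_radial h0 k hx (fun r => Real.exp (-s * r ^ 2)) (by fun_prop)
  have hCR1 : ∫ z, Real.exp (-s * ‖z‖ ^ 2) * R ‖z‖ ∂(Mk μ k) = CR :=
    H.integral_norm h0 k (fun r => Real.exp (-s * r ^ 2) * R r) (by fun_prop)
  have hexp : ∀ z : E, Real.exp (-s * ‖z - t • x‖ ^ 2) = Real.exp (-s * ‖z‖ ^ 2) *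
      Real.exp (s * (2 * inner ℝ (t • x) z - ‖t • x‖ ^ 2)) := by
    intro z
    rw [← Real.exp_add, norm_sub_sq_real, real_inner_comm]
    ring_nf
  have i0 : Integrable (fun z => Real.exp (-s * ‖z - t • x‖ ^ 2)) (Mk μ k) := by
    simp_rw [hexp]
    apply H.integrable_gauss h0 k s hs _ (by fun_prop) (2 * s * ‖t • x‖) 1
    intro z
    rw [abs_of_pos (Real.exp_pos _), one_mul]
    apply Real.exp_le_exp.mpr
    have := (le_abs_self _).trans (abs_real_inner_le_norm (t • x) z)
    have h2 : 0 ≤ s * ‖t • x‖ ^ 2 := by positivity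
    nlinarith
  have hmain : |∫ z, (Real.exp (-s * ‖z - t • x‖ ^ 2) - Real.exp (-s * ‖z‖ ^ 2) -
      (2 * s * t * (Real.exp (-s * ‖z‖ ^ 2) * inner ℝ x z) -
        s * t ^ 2 * X ^ 2 * Real.exp (-s * ‖z‖ ^ 2) +
        2 * s ^ 2 * t ^ 2 * (Real.exp (-s * ‖z‖ ^ 2) * (inner ℝ x z) ^ 2))) ∂(Mk μ k)| ≤ t ^ 3 * CR := by
    rw [← hCR1, ← integral_const_mul, ← Real.norm_eq_abs]
    apply norm_integral_le_of_norm_le ((hRi k).const_mul _)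
    refine ae_of_all _ fun z => ?_
    have := taylor_pt s t X hs ht0 ht1 (t • x) z hX0
      (by rw [norm_smul, Real.norm_of_nonneg ht0.le])
    have e : Real.exp (-s * ‖z - t • x‖ ^ 2) - Real.exp (-s * ‖z‖ ^ 2) -
      (2 * s * t * (Real.exp (-s * ‖z‖ ^ 2) * inner ℝ x z) -
        s * t ^ 2 * X ^ 2 * Real.exp (-s * ‖z‖ ^ 2) +
        2 * s ^ 2 * t ^ 2 * (Real.exp (-s * ‖z‖ ^ 2) * (inner ℝ x z) ^ 2)) =
        Real.exp (-s * ‖z‖ ^ 2) * (Real.exp (s * (2 * inner ℝ (t • x) z - ‖t • x‖ ^ 2)) - 1 -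
      s * (2 * inner ℝ (t • x) z - ‖t • x‖ ^ 2 + 2 * s * (inner ℝ (t • x) z) ^ 2)) := by
      rw [hexp z, real_inner_smul_left, norm_smul, Real.norm_of_nonneg ht0.le]
      ring
    rw [e, Real.norm_eq_abs, abs_mul, abs_of_pos (Real.exp_pos _)]
    calc _ ≤ Real.exp (-s * ‖z‖ ^ 2) * (t ^ 3 * R ‖z‖) := by gcongr
      _ = _ := by ring
  have j1 := H.int_one h0 s hs k
  have j2 := H.int_lin h0 s hs k x
  have j3 := H.int_sq h0 s hs k x
  have p1 : Integrable (fun z => Real.exp (-s * ‖z - t • x‖ ^ 2) - Real.exp (-s * ‖z‖ ^ 2)) (Mk μ k) :=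
    i0.sub j1
  have p2 : Integrable (fun z => 2 * s * t * (Real.exp (-s * ‖z‖ ^ 2) * inner ℝ x z) -
        s * t ^ 2 * X ^ 2 * Real.exp (-s * ‖z‖ ^ 2)) (Mk μ k) :=
    (j2.const_mul _).sub (j1.const_mul _)
  have p3 : Integrable (fun z => 2 * s * t * (Real.exp (-s * ‖z‖ ^ 2) * inner ℝ x z) -
        s * t ^ 2 * X ^ 2 * Real.exp (-s * ‖z‖ ^ 2) +
        2 * s ^ 2 * t ^ 2 * (Real.exp (-s * ‖z‖ ^ 2) * (inner ℝ x z) ^ 2)) (Mk μ k) :=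
    p2.add (j3.const_mul _)
  rw [integral_sub p1 p3, integral_sub i0 j1, integral_add p2 (j3.const_mul _),
    integral_sub (j2.const_mul _) (j1.const_mul _), integral_const_mul, integral_const_mul,
    integral_const_mul, hI1, hI2, ← hA, ← hQ] at hmain
  have e2 : I - I - (2 * s * t * A - s * t ^ 2 * X ^ 2 * I + 2 * s ^ 2 * t ^ 2 * Q) =
      -(s * t ^ 2) * (2 * 2 ^ k * A - X ^ 2 * I + 2 * s * Q) := by
    linear_combination (2 * s * t * A) * ht2
  rw [e2, abs_mul, abs_neg, abs_of_pos (by positivity : 0 < s * t ^ 2)] at hmain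
  have h5 : (s * t ^ 2) * |2 * 2 ^ k * A - X ^ 2 * I + 2 * s * Q| ≤ (s * t ^ 2) * (CR / s * t) := by
    refine hmain.trans (le_of_eq ?_)
    field_simp
  exact le_of_mul_le_mul_left h5 (by positivity)

end UDsec3


section UDsec4
variable {E : Type*} [NormedAddCommGroup E] [InnerProductSpace ℝ E] [FiniteDimensional ℝ E]
  [MeasurableSpace E] [BorelSpace E]
variable {μ : Measure E} {S : Set E} {h : ℝ → ℝ}

lemma perp_norm (e x : E) (he : ‖e‖ = 1) :
    inner ℝ e (x - (inner ℝ e x : ℝ) • e) = 0 ∧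
    ‖x - (inner ℝ e x : ℝ) • e‖ ^ 2 = ‖x‖ ^ 2 - (inner ℝ e x : ℝ) ^ 2 := by
  have hee : inner ℝ e e = (1 : ℝ) := by rw [real_inner_self_eq_norm_sq, he]; norm_num
  constructor
  · rw [inner_sub_right, inner_smul_right, hee]; ring
  · rw [norm_sub_sq_real, inner_smul_right, norm_smul, he, real_inner_comm]
    simp only [Real.norm_eq_abs, mul_one, sq_abs]; ring

lemma tube_la (q : E → ℝ) (b : E) (hS : ∀ x ∈ S, ‖x‖ ^ 2 - q x = inner ℝ b x)
    (unb : ∀ R : ℝ, ∃ x ∈ S, R < ‖x‖)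
    (hq0 : ∀ x, 0 ≤ q x)
    (hqa : ∀ x y, ∀ η > 0, q (x + y) ≤ (1 + η) * q x + (1 + 1 / η) * q y)
    (hqd : ∀ e v, ‖e‖ = 1 → inner ℝ e v = (0 : ℝ) → q e * ‖v‖ ^ 2 + q v ≤ ‖v‖ ^ 2)
    (hqh : ∀ (c : ℝ) x, q (c • x) = c ^ 2 * q x)
    (hqc : ∀ x, q x ≤ ‖x‖ ^ 2) :
    ∃ e, ‖e‖ = 1 ∧ ∀ x ∈ S, ‖x - (inner ℝ e x : ℝ) • e‖ ^ 2 ≤ inner ℝ b x := by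
  choose x hxS hx using fun n : ℕ => unb (n + 1)
  have hxp : ∀ n, 0 < ‖x n‖ := fun n => lt_trans (by positivity) (hx n)
  set en : ℕ → E := fun n => ‖x n‖⁻¹ • x n with hen
  have hen1 : ∀ n, en n ∈ sphere (0 : E) 1 := by
    intro n
    rw [mem_sphere_zero_iff_norm, hen, norm_smul, norm_inv, norm_norm, inv_mul_cancel₀ (hxp n).ne']
  obtain ⟨e, he, φ, hφ, hlim⟩ := (isCompact_sphere (0 : E) 1).tendsto_subseq hen1
  rw [mem_sphere_zero_iff_norm] at he
  have hqn : ∀ n, 1 - ‖b‖ / ‖x n‖ ≤ q (en n) := by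
    intro n
    rw [hen, hqh]
    have h1 := hS (x n) (hxS n)
    have h2 := (le_abs_self _).trans (abs_real_inner_le_norm b (x n))
    have h3 : ‖x n‖ ^ 2 - ‖b‖ * ‖x n‖ ≤ q (x n) := by linarith
    have h4 := mul_le_mul_of_nonneg_left h3 (sq_nonneg ‖x n‖⁻¹)
    refine le_trans (le_of_eq ?_) h4
    have := (hxp n).ne'
    field_simp
  have hinf : Tendsto (fun n => ‖x (φ n)‖) atTop atTop := by
    refine tendsto_atTop_mono (f := fun n : ℕ => (n : ℝ)) (fun n => ?_) tendsto_natCast_atTop_atTop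
    have h1 := hx (φ n)
    have h2 : (n : ℝ) ≤ φ n := by exact_mod_cast hφ.le_apply
    linarith
  have key : ∀ η > 0, 1 ≤ (1 + η) * q e := by
    intro η hη
    have t1 : Tendsto (fun n => 1 - ‖b‖ / ‖x (φ n)‖) atTop (𝓝 (1 - 0)) :=
      tendsto_const_nhds.sub (hinf.const_div_atTop _)
    have t2 : Tendsto (fun n => (1 + η) * q e + (1 + 1 / η) * ‖en (φ n) - e‖ ^ 2) atTop
        (𝓝 ((1 + η) * q e + (1 + 1 / η) * ‖e - e‖ ^ 2)) := by
      apply Tendsto.add tendsto_const_nhds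
      apply Tendsto.mul tendsto_const_nhds
      exact ((hlim.sub tendsto_const_nhds).norm).pow 2
    have := le_of_tendsto_of_tendsto' t1 t2 (fun n => by
      refine (hqn _).trans ?_
      have := hqa e (en (φ n) - e) η hη
      rw [add_sub_cancel] at this
      refine this.trans ?_
      have := hqc (en (φ n) - e)
      gcongr)
    simpa using this
  have hqe : 1 ≤ q e := by
    by_contra hc
    push Not at hc
    have := key ((1 - q e) / 2) (by linarith)
    nlinarith [hq0 e]
  refine ⟨e, he, fun y hy => ?_⟩
  obtain ⟨p1, p2⟩ := perp_norm e y he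
  set v := y - (inner ℝ e y : ℝ) • e with hv
  have hqv : q v ≤ 0 := by
    have := hqd e v he p1
    nlinarith [sq_nonneg ‖v‖]
  have hqy : ∀ η > 0, q y ≤ (1 + η) * (inner ℝ e y : ℝ) ^ 2 := by
    intro η hη
    have h1 := hqa ((inner ℝ e y : ℝ) • e) v η hη
    rw [hv, add_sub_cancel, ← hv, hqh] at h1
    have h2 : q e ≤ 1 := by have := hqc e; rw [he] at this; linarith
    have h3 : (1 + 1 / η) * q v ≤ 0 := mul_nonpos_of_nonneg_of_nonpos (by positivity) hqv
    have h4 : (1 + η) * ((inner ℝ e y : ℝ) ^ 2 * q e) ≤ (1 + η) * ((inner ℝ e y : ℝ) ^ 2 * 1) := by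
      gcongr
    linarith
  have hqy' : q y ≤ (inner ℝ e y : ℝ) ^ 2 := by
    have t : Tendsto (fun η : ℝ => (1 + η) * (inner ℝ e y : ℝ) ^ 2) (𝓝[>] 0)
        (𝓝 ((1 + 0) * (inner ℝ e y : ℝ) ^ 2)) := by
      apply Tendsto.mono_left _ nhdsWithin_le_nhds
      apply Continuous.tendsto; fun_prop
    have := ge_of_tendsto t (b := q y) (by
      filter_upwards [self_mem_nhdsWithin] with η hη using hqy η hη)
    simpa using this
  have := hS y hy
  rw [p2]; linarith

lemma UD.Mk_ae (H : UD μ S h) (k : ℕ) : ∀ᵐ z ∂(Mk μ k), ((2 : ℝ) ^ k) • z ∈ S := by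
  rw [Mk]
  apply Measure.ae_smul_measure
  have hm : MeasurableSet {z : E | ((2 : ℝ) ^ k) • z ∈ S} :=
    (H.closed.preimage (by fun_prop : Continuous fun z : E => ((2 : ℝ) ^ k) • z)).measurableSet
  rw [ae_map_iff (by fun_prop) hm]
  have : ∀ᵐ y ∂μ, y ∈ S := by
    rw [ae_iff]; exact H.null
  filter_upwards [this] with y hy
  rw [smul_smul, ← mul_pow]
  simpa using hy

lemma UD.unbounded (H : UD μ S h) (h0 : (0 : E) ∈ S) (R : ℝ) : ∃ x ∈ S, R < ‖x‖ := by
  by_contra hc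
  push Not at hc
  set r := |R| + 1 with hr
  have hr0 : 0 < r := by positivity
  have h1 := H.ball 0 h0 r hr0
  have h2 := H.ball 0 h0 (2 * r) (by positivity)
  have h3 : μ (Metric.ball 0 (2 * r)) ≤ μ (Metric.ball 0 r) := by
    have : Metric.ball (0 : E) (2 * r) ⊆ Metric.ball 0 r ∪ Sᶜ := by
      intro x hx
      by_cases hxS : x ∈ S
      · left
        have := hc x hxS
        have := le_abs_self R
        simp; linarith
      · right; exact hxS
    calc _ ≤ μ (Metric.ball 0 r ∪ Sᶜ) := measure_mono this
      _ ≤ _ := measure_union_le _ _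
      _ = _ := by rw [H.null, add_zero]
  rw [h1, h2, ENNReal.ofReal_le_ofReal_iff (H.pos r hr0).le, H.dbl r hr0] at h3
  linarith [H.pos r hr0]

lemma UD.I_pos (H : UD μ S h) (h0 : (0 : E) ∈ S) (s : ℝ) (hs : 0 < s) :
    0 < ∫ z, Real.exp (-s * ‖z‖ ^ 2) ∂μ := by
  have : NeZero μ := ⟨fun hz => by
    have := H.ball 0 h0 1 one_pos
    rw [hz] at this
    simp at this
    linarith [H.pos 1 one_pos]⟩
  exact integral_exp_pos (H.integrable_gauss0 h0 s hs)

lemma UD.M1_pos (H : UD μ S h) (h0 : (0 : E) ∈ S) (s : ℝ) (hs : 0 < s) :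
    0 < ∫ z, Real.exp (-s * ‖z‖ ^ 2) * ‖z‖ ∂μ := by
  have hi := H.int_norm h0 s hs 0
  rw [Mk_zero] at hi
  rw [integral_pos_iff_support_of_nonneg (fun z => by positivity) hi]
  by_contra hc
  have hc' : μ (Function.support fun z : E => Real.exp (-s * ‖z‖ ^ 2) * ‖z‖) = 0 := by
    simpa using hc
  have hsub : Metric.ball (0 : E) 2 ⊆ Metric.ball 0 1 ∪
      (Function.support fun z : E => Real.exp (-s * ‖z‖ ^ 2) * ‖z‖) := by
    intro x hx
    by_cases hx0 : x = 0
    · left; simp [hx0]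
    · right
      rw [Function.mem_support]
      have : 0 < ‖x‖ := norm_pos_iff.mpr hx0
      positivity
  have h3 : μ (Metric.ball 0 2) ≤ μ (Metric.ball 0 1) := by
    calc _ ≤ _ := measure_mono hsub
      _ ≤ _ := measure_union_le _ _
      _ = _ := by rw [hc', add_zero]
  have h2 := H.dbl 1 one_pos
  rw [mul_one] at h2
  rw [H.ball 0 h0 1 one_pos, H.ball 0 h0 2 two_pos, 
    ENNReal.ofReal_le_ofReal_iff (H.pos 1 one_pos).le, h2] at h3
  linarith [H.pos 1 one_pos]

end UDsec4


section UDsec5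
variable {E : Type*} [NormedAddCommGroup E] [InnerProductSpace ℝ E] [FiniteDimensional ℝ E]
  [MeasurableSpace E] [BorelSpace E]
variable {μ : Measure E} {S : Set E} {h : ℝ → ℝ}

/-- bounds for the second moments -/
lemma UD.qbounds (H : UD μ S h) (h0 : (0 : E) ∈ S) (s : ℝ) (hs : 0 < s)
    (hsJ : 2 * s * ∫ z, Real.exp (-s * ‖z‖ ^ 2) * ‖z‖ ^ 2 ∂μ ≤ ∫ z, Real.exp (-s * ‖z‖ ^ 2) ∂μ)
    (q : ℕ → E → ℝ) (hq : ∀ k x, q k x = 2 * s / (∫ z, Real.exp (-s * ‖z‖ ^ 2) ∂μ) *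
      ∫ z, Real.exp (-s * ‖z‖ ^ 2) * (inner ℝ x z) ^ 2 ∂(Mk μ k)) (k : ℕ) :
    (∀ x, 0 ≤ q k x) ∧
    (∀ x y, ∀ η > 0, q k (x + y) ≤ (1 + η) * q k x + (1 + 1 / η) * q k y) ∧
    (∀ e v, ‖e‖ = 1 → inner ℝ e v = (0 : ℝ) → q k e * ‖v‖ ^ 2 + q k v ≤ ‖v‖ ^ 2) ∧
    (∀ (c : ℝ) x, q k (c • x) = c ^ 2 * q k x) ∧
    (∀ x, q k x ≤ ‖x‖ ^ 2) := by
  have hI0 := H.I_pos h0 s hs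
  set I := ∫ z, Real.exp (-s * ‖z‖ ^ 2) ∂μ with hI
  have hJ1 : ∫ z, Real.exp (-s * ‖z‖ ^ 2) * ‖z‖ ^ 2 ∂(Mk μ k) =
      ∫ z, Real.exp (-s * ‖z‖ ^ 2) * ‖z‖ ^ 2 ∂μ :=
    H.integral_norm h0 k (fun r => Real.exp (-s * r ^ 2) * r ^ 2) (by fun_prop)
  have hJ2 : 2 * s / I * ∫ z, Real.exp (-s * ‖z‖ ^ 2) * ‖z‖ ^ 2 ∂(Mk μ k) ≤ 1 := by
    rw [hJ1, div_mul_eq_mul_div, div_le_one hI0]; exact hsJ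
  have j := H.int_sq h0 s hs k
  have jn := H.int_nsq h0 s hs k
  have c0 : 0 ≤ 2 * s / I := by positivity
  refine ⟨?_, ?_, ?_, ?_, ?_⟩
  · intro x
    rw [hq]
    exact mul_nonneg c0 (integral_nonneg fun z => by positivity)
  · intro x y η hη
    rw [hq, hq, hq]
    have : ∫ z, Real.exp (-s * ‖z‖ ^ 2) * (inner ℝ (x + y) z) ^ 2 ∂(Mk μ k) ≤
        (1 + η) * (∫ z, Real.exp (-s * ‖z‖ ^ 2) * (inner ℝ x z) ^ 2 ∂(Mk μ k)) +
        (1 + 1 / η) * (∫ z, Real.exp (-s * ‖z‖ ^ 2) * (inner ℝ y z) ^ 2 ∂(Mk μ k)) := by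
      rw [← integral_const_mul, ← integral_const_mul,
        ← integral_add ((j x).const_mul _) ((j y).const_mul _)]
      apply integral_mono (j (x + y)) (((j x).const_mul _).add ((j y).const_mul _))
      intro z
      simp only [Pi.add_apply]
      rw [inner_add_left]
      set a : ℝ := inner ℝ x z
      set b : ℝ := inner ℝ y z
      have : (a + b) ^ 2 ≤ (1 + η) * a ^ 2 + (1 + 1 / η) * b ^ 2 := by
        have : (1 + η) * a ^ 2 + (1 + 1 / η) * b ^ 2 - (a + b) ^ 2 = (η * a - b) ^ 2 / η := by
          field_simp; ring
        have h2 : 0 ≤ (η * a - b) ^ 2 / η := by positivity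
        linarith
      have h3 := mul_le_mul_of_nonneg_left this (Real.exp_pos (-s * ‖z‖ ^ 2)).le
      linarith
    have := mul_le_mul_of_nonneg_left this c0
    linarith
  · intro e v he hev
    rw [hq, hq]
    have : ‖v‖ ^ 2 * (∫ z, Real.exp (-s * ‖z‖ ^ 2) * (inner ℝ e z) ^ 2 ∂(Mk μ k)) +
        (∫ z, Real.exp (-s * ‖z‖ ^ 2) * (inner ℝ v z) ^ 2 ∂(Mk μ k)) ≤
        ‖v‖ ^ 2 * ∫ z, Real.exp (-s * ‖z‖ ^ 2) * ‖z‖ ^ 2 ∂(Mk μ k) := by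
      rw [← integral_const_mul, ← integral_const_mul,
        ← integral_add ((j e).const_mul _) (j v)]
      apply integral_mono (((j e).const_mul _).add (j v)) (jn.const_mul _)
      intro z
      simp only [Pi.add_apply]
      obtain ⟨p1, p2⟩ := perp_norm e z he
      have hvz : (inner ℝ v z : ℝ) = inner ℝ v (z - (inner ℝ e z : ℝ) • e) := by
        rw [inner_sub_right, inner_smul_right, real_inner_comm e v, hev]; ring
      have h2 : (inner ℝ v z : ℝ) ^ 2 ≤ ‖v‖ ^ 2 * (‖z‖ ^ 2 - (inner ℝ e z : ℝ) ^ 2) := by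
        rw [← p2, ← mul_pow, hvz, ← sq_abs]
        gcongr
        exact abs_real_inner_le_norm _ _
      have h3 := mul_le_mul_of_nonneg_left h2 (Real.exp_pos (-s * ‖z‖ ^ 2)).le
      linarith
    have h1 := mul_le_mul_of_nonneg_left this c0
    have h2 := mul_le_mul_of_nonneg_left hJ2 (sq_nonneg ‖v‖)
    linarith
  · intro c x
    rw [hq, hq]
    have : ∀ z : E, Real.exp (-s * ‖z‖ ^ 2) * (inner ℝ (c • x) z) ^ 2 =
      c ^ 2 * (Real.exp (-s * ‖z‖ ^ 2) * (inner ℝ x z) ^ 2) := by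
      intro z; rw [real_inner_smul_left]; ring
    simp_rw [this]
    rw [integral_const_mul]; ring
  · intro x
    rw [hq]
    have : (∫ z, Real.exp (-s * ‖z‖ ^ 2) * (inner ℝ x z) ^ 2 ∂(Mk μ k)) ≤
        ‖x‖ ^ 2 * ∫ z, Real.exp (-s * ‖z‖ ^ 2) * ‖z‖ ^ 2 ∂(Mk μ k) := by
      rw [← integral_const_mul]
      apply integral_mono (j x) (jn.const_mul _)
      intro z
      simp only
      have h2 : (inner ℝ x z : ℝ) ^ 2 ≤ ‖x‖ ^ 2 * ‖z‖ ^ 2 := by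
        rw [← mul_pow, ← sq_abs]
        gcongr
        exact abs_real_inner_le_norm _ _
      have h3 := mul_le_mul_of_nonneg_left h2 (Real.exp_pos (-s * ‖z‖ ^ 2)).le
      linarith
    have h1 := mul_le_mul_of_nonneg_left this c0
    have h2 := mul_le_mul_of_nonneg_left hJ2 (sq_nonneg ‖x‖)
    linarith

/-- pointwise limits of linear functionals are given by a vector -/
lemma lin_limit (U : Ultrafilter ℕ) (L : ℕ → E →ₗ[ℝ] ℝ)
    (hS : ∀ x ∈ S, ∃ l, Tendsto (fun k => L k x) U (𝓝 l))
    (hperp : ∀ x, (∀ y ∈ S, inner ℝ y x = (0 : ℝ)) → ∀ k, L k x = 0) :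
    ∃ b : E, ∀ x, Tendsto (fun k => L k x) U (𝓝 (inner ℝ b x)) := by
  let W : Submodule ℝ E :=
    { carrier := {x | ∃ l, Tendsto (fun k => L k x) U (𝓝 l)}
      add_mem' := by
        rintro x y ⟨l, hl⟩ ⟨m, hm⟩
        exact ⟨l + m, by simpa using hl.add hm⟩
      zero_mem' := ⟨0, by simp⟩
      smul_mem' := by
        rintro c x ⟨l, hl⟩
        exact ⟨c * l, by simpa using hl.const_mul c⟩ }
  have hall : ∀ x, ∃ l, Tendsto (fun k => L k x) U (𝓝 l) := by
    intro x
    obtain ⟨y, hy, z, hz, rfl⟩ := W.exists_add_mem_mem_orthogonal x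
    have : z ∈ W := by
      refine ⟨0, ?_⟩
      have hz0 : ∀ k, L k z = 0 := hperp z fun w hw => (Submodule.mem_orthogonal W z).mp hz w (hS w hw)
      simp [hz0]
    exact W.add_mem hy this
  choose l hl using hall
  let ℓ : E →ₗ[ℝ] ℝ :=
    { toFun := l
      map_add' := fun x y => tendsto_nhds_unique (hl (x + y)) (by simpa using (hl x).add (hl y))
      map_smul' := fun c x => tendsto_nhds_unique (hl (c • x)) (by simpa using (hl x).const_mul c) }
  refine ⟨(InnerProductSpace.toDual ℝ E).symm (LinearMap.toContinuousLinearMap ℓ), fun x => ?_⟩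
  rw [InnerProductSpace.toDual_symm_apply]
  exact hl x

lemma UD.tube0 (H : UD μ S h) (h0 : (0 : E) ∈ S) :
    ∃ e : E, ‖e‖ = 1 ∧ ∃ K : ℝ, ∀ x ∈ S, ‖x - (inner ℝ e x : ℝ) • e‖ ≤ K := by
  obtain ⟨s, hs, hsJ⟩ := H.exists_s h0
  have hI0 := H.I_pos h0 s hs
  have hM1 := H.M1_pos h0 s hs
  set U : Ultrafilter ℕ := Filter.hyperfilter ℕ with hU
  have hUtop : (U : Filter ℕ) ≤ atTop := by
    rw [← Nat.cofinite_eq_atTop]; exact Filter.hyperfilter_le_cofinite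
  set I := ∫ z, Real.exp (-s * ‖z‖ ^ 2) ∂μ with hI
  set q : ℕ → E → ℝ := fun k x => 2 * s / I *
      ∫ z, Real.exp (-s * ‖z‖ ^ 2) * (inner ℝ x z) ^ 2 ∂(Mk μ k) with hq
  have hqb := H.qbounds h0 s hs hsJ q (fun _ _ => rfl)
  set L : ℕ → E →ₗ[ℝ] ℝ := fun k =>
    { toFun := fun x => 2 * 2 ^ k / I * ∫ z, Real.exp (-s * ‖z‖ ^ 2) * inner ℝ x z ∂(Mk μ k)
      map_add' := by
        intro x y
        rw [← mul_add, ← integral_add (H.int_lin h0 s hs k x) (H.int_lin h0 s hs k y)]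
        congr 2; ext z; rw [inner_add_left]; ring
      map_smul' := by
        intro c x
        simp only [RingHom.id_apply, smul_eq_mul]
        rw [mul_left_comm, ← integral_const_mul c]
        congr 1
        refine integral_congr_ae (ae_of_all _ fun z => ?_)
        simp only
        rw [real_inner_smul_left]; ring } with hL
  have hLdef : ∀ k x, L k x = 2 * 2 ^ k / I *
    ∫ z, Real.exp (-s * ‖z‖ ^ 2) * inner ℝ x z ∂(Mk μ k) := fun k x => rfl
  -- limits of q
  have hqlim : ∀ x, ∃ l, Tendsto (fun k => q k x) U (𝓝 l) := fun x =>
    ultra_lim U _ (‖x‖ ^ 2) (Eventually.of_forall fun k => by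
      rw [abs_of_nonneg ((hqb k).1 x)]; exact (hqb k).2.2.2.2 x)
  choose ql hql using hqlim
  have hsum : ∀ x ∈ S, Tendsto (fun k => L k x + q k x) U (𝓝 (‖x‖ ^ 2)) := by
    intro x hx
    obtain ⟨C, hC⟩ := H.taylor_int h0 s hs hx
    have : Tendsto (fun k : ℕ => C / I * (1 / 2 : ℝ) ^ k) atTop (𝓝 0) := by
      have := (tendsto_pow_atTop_nhds_zero_of_lt_one (by norm_num : (0 : ℝ) ≤ 1 / 2)
        (by norm_num)).const_mul (C / I)
      simpa using this
    rw [tendsto_iff_dist_tendsto_zero]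
    refine squeeze_zero (fun _ => dist_nonneg) (fun k => ?_) (this.mono_left hUtop)
    rw [Real.dist_eq, hLdef, hq]
    have h1 := hC k
    set A := ∫ z, Real.exp (-s * ‖z‖ ^ 2) * inner ℝ x z ∂(Mk μ k)
    set Q := ∫ z, Real.exp (-s * ‖z‖ ^ 2) * (inner ℝ x z) ^ 2 ∂(Mk μ k)
    have e : 2 * 2 ^ k / I * A + 2 * s / I * Q - ‖x‖ ^ 2 =
      (2 * 2 ^ k * A - ‖x‖ ^ 2 * I + 2 * s * Q) / I := by field_simp; ring
    simp only
    rw [e, abs_div, abs_of_pos hI0, div_le_iff₀ hI0]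
    refine h1.trans (le_of_eq ?_)
    field_simp
  have hLS : ∀ x ∈ S, Tendsto (fun k => L k x) U (𝓝 (‖x‖ ^ 2 - ql x)) := by
    intro x hx
    have := (hsum x hx).sub (hql x)
    simpa using this
  obtain ⟨b, hb⟩ := lin_limit U L (fun x hx => ⟨_, hLS x hx⟩) (by
    intro x hx k
    rw [hLdef]
    have : ∫ z, Real.exp (-s * ‖z‖ ^ 2) * inner ℝ x z ∂(Mk μ k) = 0 := by
      apply integral_eq_zero_of_ae
      filter_upwards [H.Mk_ae k] with z hz
      have h1 := hx _ hz
      rw [real_inner_smul_left] at h1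
      have h2 : inner ℝ z x = (0 : ℝ) := by
        rcases mul_eq_zero.mp h1 with h | h
        · exact absurd h (by positivity)
        · exact h
      rw [real_inner_comm, h2]; simp
    rw [this, mul_zero])
  have hSb : ∀ x ∈ S, ‖x‖ ^ 2 - ql x = inner ℝ b x := fun x hx =>
    tendsto_nhds_unique (hLS x hx) (hb x)
  obtain ⟨e, he, hex⟩ := tube_la ql b hSb (H.unbounded h0)
    (fun x => ge_of_tendsto' (hql x) fun k => (hqb k).1 x)
    (fun x y η hη => le_of_tendsto_of_tendsto' (hql _)
      (((hql x).const_mul _).add ((hql y).const_mul _)) fun k => (hqb k).2.1 x y η hη)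
    (fun e v he hev => le_of_tendsto' (((hql e).mul_const _).add (hql v))
      fun k => (hqb k).2.2.1 e v he hev)
    (fun c x => tendsto_nhds_unique (hql (c • x)) (by
      simp_rw [(hqb _).2.2.2.1 c x]; exact (hql x).const_mul _))
    (fun x => le_of_tendsto' (hql x) fun k => (hqb k).2.2.2.2 x)
  -- sign normalisation
  have hex' : ∃ e : E, ‖e‖ = 1 ∧ 0 ≤ (inner ℝ b e : ℝ) ∧
      ∀ x ∈ S, ‖x - (inner ℝ e x : ℝ) • e‖ ^ 2 ≤ inner ℝ b x := by
    by_cases hbe : 0 ≤ (inner ℝ b e : ℝ)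
    · exact ⟨e, he, hbe, hex⟩
    · refine ⟨-e, by simpa using he, by rw [inner_neg_right]; linarith, ?_⟩
      simpa using hex
  obtain ⟨e, he, hbe, hex⟩ := hex'
  refine ⟨e, he, ‖b‖, ?_⟩
  set β : ℝ := inner ℝ b e with hβ
  have hsplit : ∀ x : E, (inner ℝ b x : ℝ) ≤
      β * inner ℝ e x + ‖b‖ * ‖x - (inner ℝ e x : ℝ) • e‖ := by
    intro x
    have e1 : (inner ℝ b x : ℝ) = β * inner ℝ e x + inner ℝ b (x - (inner ℝ e x : ℝ) • e) := by
      rw [inner_sub_right, inner_smul_right]; ring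
    have := (le_abs_self _).trans (abs_real_inner_le_norm b (x - (inner ℝ e x : ℝ) • e))
    linarith
  rcases hbe.eq_or_lt with h00 | hpos
  · intro x hx
    have h1 := hex x hx
    have h2 := hsplit x
    rw [← h00] at h2
    set n := ‖x - (inner ℝ e x : ℝ) • e‖
    have hn : 0 ≤ n := norm_nonneg _
    by_contra hc
    push Not at hc
    nlinarith [norm_nonneg b]
  · exfalso
    -- |y| ≤ (1+β) y1 + C on S
    obtain ⟨C, hC⟩ : ∃ C : ℝ, ∀ y ∈ S, ‖y‖ ≤ (1 + β) * inner ℝ e y + C := by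
      refine ⟨‖b‖ ^ 2 / β + ‖b‖ ^ 2 / 2 + 1 / 2, fun y hy => ?_⟩
      have h1 := (hex y hy).trans (hsplit y)
      set n := ‖y - (inner ℝ e y : ℝ) • e‖ with hn
      set y1 : ℝ := inner ℝ e y with hy1
      have h3 : n ^ 2 / 2 ≤ β * y1 + ‖b‖ ^ 2 / 2 := by nlinarith [sq_nonneg (n - ‖b‖)]
      have h4 : -(‖b‖ ^ 2 / (2 * β)) ≤ y1 := by
        rw [neg_le, le_div_iff₀ (by positivity)]
        nlinarith [sq_nonneg n]
      have h5 : |y1| ≤ y1 + ‖b‖ ^ 2 / β := by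
        have : ‖b‖ ^ 2 / β = 2 * (‖b‖ ^ 2 / (2 * β)) := by field_simp
        have h6 : 0 ≤ ‖b‖ ^ 2 / (2 * β) := by positivity
        rw [abs_le]; constructor <;> linarith
      have h6 : ‖y‖ ≤ |y1| + n := by
        have : ‖y‖ ≤ ‖y1 • e‖ + ‖y - y1 • e‖ := by
          calc ‖y‖ = ‖y1 • e + (y - y1 • e)‖ := by congr 1; abel
            _ ≤ _ := norm_add_le _ _
        rwa [norm_smul, he, mul_one, Real.norm_eq_abs] at this
      nlinarith [sq_nonneg (n - 1)]
    have hlow : ∀ k, 2 * 2 ^ k / I * (∫ z, Real.exp (-s * ‖z‖ ^ 2) * ‖z‖ ∂μ) ≤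
        (1 + β) * L k e + 2 * C := by
      intro k
      have hN : ∫ z, Real.exp (-s * ‖z‖ ^ 2) * ‖z‖ ∂(Mk μ k) =
        ∫ z, Real.exp (-s * ‖z‖ ^ 2) * ‖z‖ ∂μ :=
        H.integral_norm h0 k (fun r => Real.exp (-s * r ^ 2) * r) (by fun_prop)
      have hI1 : ∫ z, Real.exp (-s * ‖z‖ ^ 2) ∂(Mk μ k) = I :=
        H.integral_norm h0 k (fun r => Real.exp (-s * r ^ 2)) (by fun_prop)
      have h1 : ∫ z, Real.exp (-s * ‖z‖ ^ 2) * ‖z‖ ∂(Mk μ k) ≤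
          (1 + β) * (∫ z, Real.exp (-s * ‖z‖ ^ 2) * inner ℝ e z ∂(Mk μ k)) + C / 2 ^ k * I := by
        rw [← hI1, ← integral_const_mul, ← integral_const_mul,
          ← integral_add ((H.int_lin h0 s hs k e).const_mul _) ((H.int_one h0 s hs k).const_mul _)]
        apply integral_mono_ae (H.int_norm h0 s hs k)
          (((H.int_lin h0 s hs k e).const_mul _).add ((H.int_one h0 s hs k).const_mul _))
        filter_upwards [H.Mk_ae k] with z hz
        simp only [Pi.add_apply]
        have h2 := hC _ hz
        rw [norm_smul, inner_smul_right, Real.norm_of_nonneg (by positivity)] at h2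
        have h3 : ‖z‖ ≤ (1 + β) * inner ℝ e z + C / 2 ^ k := by
          have e3 : (1 + β) * inner ℝ e z + C / 2 ^ k =
            ((1 + β) * (2 ^ k * inner ℝ e z) + C) / 2 ^ k := by field_simp
          rw [e3, le_div_iff₀ (by positivity)]; linarith
        have h4 := mul_le_mul_of_nonneg_left h3 (Real.exp_pos (-s * ‖z‖ ^ 2)).le
        linarith
      rw [hN] at h1
      have h5 := mul_le_mul_of_nonneg_left h1 (by positivity : 0 ≤ 2 * 2 ^ k / I)
      rw [hLdef]
      refine h5.trans (le_of_eq ?_)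
      field_simp
    have hinf : Tendsto (fun k : ℕ => 2 * 2 ^ k / I *
        (∫ z, Real.exp (-s * ‖z‖ ^ 2) * ‖z‖ ∂μ)) atTop atTop := by
      apply Tendsto.atTop_mul_const hM1
      apply Tendsto.atTop_div_const hI0
      apply Tendsto.const_mul_atTop two_pos
      exact tendsto_pow_atTop_atTop_of_one_lt (by norm_num)
    have hinf2 : Tendsto (fun k => (1 + β) * L k e + 2 * C) U atTop :=
      tendsto_atTop_mono hlow (hinf.mono_left hUtop)
    have hfin : Tendsto (fun k => (1 + β) * L k e + 2 * C) U (𝓝 ((1 + β) * inner ℝ b e + 2 * C)) :=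
      ((hb e).const_mul _).add_const _
    exact not_tendsto_nhds_of_tendsto_atTop hinf2 _ hfin

end UDsec5


/-- one dimensional projected data -/
structure LD (m : Measure ℝ) (T : Set ℝ) (h : ℝ → ℝ) (D : ℝ) : Prop where
  D0 : 0 ≤ D
  closed : IsClosed T
  ne : T.Nonempty
  null : m Tᶜ = 0
  low : ∀ u ∈ T, ∀ r > 0, ENNReal.ofReal (h r) ≤ m (Set.Ioo (u - r) (u + r))
  up : ∀ u ∈ T, ∀ r > 0, m (Set.Ioo (u - r) (u + r)) ≤ ENNReal.ofReal (h (Real.sqrt (r ^ 2 + D ^ 2)))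
  pos : ∀ r > 0, 0 < h r
  dbl : ∀ r > 0, h (2 * r) = 2 * h r
  mono : ∀ a b, 0 < a → a ≤ b → h a ≤ h b

section LDsec
variable {m : Measure ℝ} {T : Set ℝ} {h : ℝ → ℝ} {D : ℝ}

lemma LD.cmp (H : LD m T h D) {A B : Set ℝ} (hAB : A ∩ T ⊆ B) : m A ≤ m B := by
  have : A ⊆ B ∪ Tᶜ := by
    intro x hx
    by_cases hT : x ∈ T
    · exact Or.inl (hAB ⟨hx, hT⟩)
    · exact Or.inr hT
  calc m A ≤ _ := measure_mono this
    _ ≤ _ := measure_union_le _ _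
    _ = _ := by rw [H.null, add_zero]

lemma LD.hcmp (H : LD m T h D) {u v r R : ℝ} (hu : u ∈ T) (hv : v ∈ T) (hr : 0 < r) (hR : 0 < R)
    (hs : Set.Ioo (u - r) (u + r) ∩ T ⊆ Set.Ioo (v - R) (v + R)) :
    h r ≤ h (Real.sqrt (R ^ 2 + D ^ 2)) := by
  have := (H.low u hu r hr).trans ((H.cmp hs).trans (H.up v hv R hR))
  rwa [ENNReal.ofReal_le_ofReal_iff (H.pos _ (by positivity)).le] at this

lemma LD.gap (H : LD m T h D) {a g : ℝ} (ha : a ∈ T) (hg : 0 < g) (hgD : 64 * D ≤ g) :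
    ∃ x ∈ T, a < x ∧ x < a + g := by
  by_contra hc
  push Not at hc
  have hD := H.D0
  have h1 : ∃ b ∈ T, g / 32 ≤ a - b ∧ a - b < g / 8 := by
    by_contra hc1
    push Not at hc1
    have h2 := H.hcmp ha ha (r := g / 8) (R := g / 32) (by positivity) (by positivity) (by
      rintro x ⟨⟨hx1, hx2⟩, hxT⟩
      have h3 : x ≤ a := by
        by_contra h4
        push Not at h4
        linarith [hc x hxT h4]
      have h5 : a - x < g / 32 := by
        by_contra h6
        push Not at h6
        linarith [hc1 x hxT h6]
      constructor <;> linarith)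
    have h3 : Real.sqrt ((g / 32) ^ 2 + D ^ 2) ≤ g / 16 := by
      apply Real.sqrt_le_iff.mpr ⟨by positivity, ?_⟩
      nlinarith
    have h4 := H.mono _ _ (by positivity) h3
    have h5 := H.dbl (g / 16) (by positivity)
    rw [show 2 * (g / 16) = g / 8 by ring] at h5
    linarith [H.pos (g / 16) (by positivity)]
  obtain ⟨b, hb, hb1, hb2⟩ := h1
  set t := a - b with ht
  have ht0 : 0 < t := by linarith [show 0 < g / 32 by positivity]
  have step : ∀ ρ, 3 * t / 2 < ρ → ρ ≤ g - t / 2 → h (ρ + t / 2) ≤ h ρ := by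
    intro ρ h1 h2
    have h3 := H.hcmp ha hb (r := ρ + t / 2) (R := ρ - t / 2) (by linarith) (by linarith) (by
      rintro x ⟨⟨hx1, hx2⟩, hxT⟩
      have h3 : x ≤ a := by
        by_contra h4
        push Not at h4
        linarith [hc x hxT h4]
      constructor <;> linarith)
    refine h3.trans (H.mono _ _ ?_ ?_)
    · have : 0 < ρ - t / 2 := by linarith
      positivity
    · apply Real.sqrt_le_iff.mpr ⟨by linarith, ?_⟩
      have : D ≤ t / 2 := by linarith
      nlinarith
  have s1 := step (2 * t) (by linarith) (by linarith)
  have s2 := step (2 * t + t / 2) (by linarith) (by linarith)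
  have s3 := step (2 * t + t / 2 + t / 2) (by linarith) (by linarith)
  have s4 := step (2 * t + t / 2 + t / 2 + t / 2) (by linarith) (by linarith)
  have h5 := H.dbl (2 * t) (by positivity)
  rw [show 2 * (2 * t) = 2 * t + t / 2 + t / 2 + t / 2 + t / 2 by ring] at h5
  linarith [H.pos (2 * t) (by positivity)]

lemma LD.dense (H : LD m T h D) {z0 z C : ℝ} (h0 : z0 ∈ T) (hC : 0 < C) (hCD : 64 * D ≤ C)
    (hz : z0 ≤ z) : ∃ u ∈ T, z ≤ u ∧ u ≤ z + C := by
  have hcomp : IsCompact (T ∩ Set.Icc z0 z) := isCompact_Icc.inter_left H.closed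
  have hmem := hcomp.sSup_mem ⟨z0, h0, le_refl _, hz⟩
  set a := sSup (T ∩ Set.Icc z0 z) with ha
  obtain ⟨x, hx, h1, h2⟩ := H.gap hmem.1 hC hCD
  refine ⟨x, hx, ?_, by linarith [hmem.2.2]⟩
  by_contra hc
  push Not at hc
  have : x ≤ a := le_csSup hcomp.bddAbove ⟨hx, by linarith [hmem.2.1], hc.le⟩
  linarith

lemma LD.fin (H : LD m T h D) (a b : ℝ) : m (Set.Ioo a b) < ∞ := by
  obtain ⟨u, hu⟩ := H.ne
  set r := |a - u| + |b - u| + 1 with hr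
  have hsub : Set.Ioo a b ⊆ Set.Ioo (u - r) (u + r) := by
    apply Set.Ioo_subset_Ioo
    · have := neg_abs_le (a - u)
      have := abs_nonneg (b - u)
      linarith
    · have := le_abs_self (b - u)
      have := abs_nonneg (a - u)
      linarith
  exact (measure_mono hsub).trans_lt ((H.up u hu r (by positivity)).trans_lt ENNReal.ofReal_lt_top)

lemma LD.fin' (H : LD m T h D) (a b : ℝ) : m (Set.Ico a b) < ∞ :=
  (measure_mono (fun x hx => ⟨by linarith [hx.1], hx.2⟩ : Set.Ico a b ⊆ Set.Ioo (a - 1) b)).trans_lt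
    (H.fin _ _)

lemma LD.pack (H : LD m T h D) {C X Y : ℝ} (hC : 0 < C) (hCD : 64 * D ≤ C) (hX : 0 < X)
    (hY : 0 < Y) (n : ℕ) (hn : n * (2 * Y + C) ≤ 2 * X) : n * h Y ≤ h (X + D) := by
  obtain ⟨z0, hz0⟩ := H.ne
  have hD := H.D0
  obtain ⟨u, hu, hu1, hu2⟩ := H.dense hz0 hC hCD (z := z0 + X) (by linarith)
  have hv : ∀ i : ℕ, ∃ v ∈ T, u - X + i * (2 * Y + C) + Y ≤ v ∧
      v ≤ u - X + i * (2 * Y + C) + Y + C := by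
    intro i
    apply H.dense hz0 hC hCD
    have : 0 ≤ (i : ℝ) * (2 * Y + C) := by positivity
    linarith
  choose v hvT hv1 hv2 using hv
  have hdis : Set.PairwiseDisjoint (↑(Finset.range n) : Set ℕ)
      (fun i => Set.Ioo (v i - Y) (v i + Y)) := by
    have key : ∀ i j : ℕ, i < j → Disjoint (Set.Ioo (v i - Y) (v i + Y)) (Set.Ioo (v j - Y) (v j + Y)) := by
      intro i j hij
      rw [Set.disjoint_left]
      rintro x ⟨_, h2⟩ ⟨h3, _⟩
      have h4 : ((i : ℝ) + 1) ≤ j := by exact_mod_cast hij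
      have h5 : ((i : ℝ) + 1) * (2 * Y + C) ≤ j * (2 * Y + C) := by gcongr
      linarith [hv2 i, hv1 j]
    intro i _ j _ hij
    rcases lt_or_gt_of_ne hij with h | h
    · exact key i j h
    · exact (key j i h).symm
  have hsum := measure_biUnion_finset (μ := m) hdis (fun i _ => measurableSet_Ioo)
  have hsub : (⋃ i ∈ Finset.range n, Set.Ioo (v i - Y) (v i + Y)) ⊆ Set.Ioo (u - X) (u + X) := by
    intro x hx
    simp only [Set.mem_iUnion, Finset.mem_range] at hx
    obtain ⟨i, hi, h1, h2⟩ := hx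
    have h4 : ((i : ℝ) + 1) ≤ n := by exact_mod_cast hi
    have h5 : ((i : ℝ) + 1) * (2 * Y + C) ≤ n * (2 * Y + C) := by gcongr
    have h6 : 0 ≤ (i : ℝ) * (2 * Y + C) := by positivity
    constructor
    · linarith [hv1 i]
    · linarith [hv2 i]
  have h1 : ENNReal.ofReal (n * h Y) ≤ ENNReal.ofReal (h (Real.sqrt (X ^ 2 + D ^ 2))) := by
    calc ENNReal.ofReal (n * h Y) = ∑ i ∈ Finset.range n, ENNReal.ofReal (h Y) := by
          rw [Finset.sum_const, Finset.card_range, nsmul_eq_mul,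
            ENNReal.ofReal_mul (by positivity), ENNReal.ofReal_natCast]
      _ ≤ ∑ i ∈ Finset.range n, m (Set.Ioo (v i - Y) (v i + Y)) :=
          Finset.sum_le_sum fun i _ => H.low _ (hvT i) Y hY
      _ = _ := hsum.symm
      _ ≤ m (Set.Ioo (u - X) (u + X)) := measure_mono hsub
      _ ≤ _ := H.up u hu X hX
  rw [ENNReal.ofReal_le_ofReal_iff (H.pos _ (by positivity)).le] at h1
  refine h1.trans (H.mono _ _ (by positivity) ?_)
  apply Real.sqrt_le_iff.mpr ⟨by positivity, ?_⟩
  nlinarith [mul_nonneg hX.le hD]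

lemma LD.pow (H : LD m T h D) (k : ℕ) {r : ℝ} (hr : 0 < r) : h (2 ^ k * r) = 2 ^ k * h r := by
  induction k with
  | zero => simp
  | succ n ih => rw [pow_succ', mul_assoc, H.dbl _ (by positivity), ih]; ring

lemma LD.linear (H : LD m T h D) : ∃ c : ℝ, 0 < c ∧ ∀ r > 0, h r = c * r := by
  have hD := H.D0
  set C := 64 * D + 1 with hC
  have hC0 : 0 < C := by positivity
  have p2 : Tendsto (fun k : ℕ => (2 : ℝ) ^ k) atTop atTop :=
    tendsto_pow_atTop_atTop_of_one_lt (by norm_num)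
  -- first limit
  have L1 : ∀ x x' Y : ℝ, 0 < x → x < x' → 0 < Y → 2 * x / (2 * Y + C) * h Y ≤ h x' := by
    intro x x' Y hx hxx hY
    have hev : ∀ᶠ k : ℕ in atTop, (2 * x / (2 * Y + C) - 1 / 2 ^ k) * h Y ≤ h x' := by
      filter_upwards [p2.eventually_ge_atTop (D / (x' - x))] with k hk
      have hk' : 2 ^ k * x + D ≤ 2 ^ k * x' := by
        rw [div_le_iff₀ (by linarith)] at hk; linarith
      set n := ⌊2 * (2 ^ k * x) / (2 * Y + C)⌋₊ with hn
      have h1 := H.pack hC0 (by linarith) (X := 2 ^ k * x) (by positivity) hY n (by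
        rw [← le_div_iff₀ (by positivity)]
        exact Nat.floor_le (by positivity))
      have h2 : 2 * (2 ^ k * x) / (2 * Y + C) - 1 ≤ n := by
        have := Nat.lt_floor_add_one (2 * (2 ^ k * x) / (2 * Y + C))
        linarith
      have h3 := H.mono _ _ (by positivity) hk'
      rw [H.pow k (by linarith)] at h3
      have h4 : (2 * (2 ^ k * x) / (2 * Y + C) - 1) * h Y ≤ 2 ^ k * h x' := by
        have := H.pos Y hY
        calc _ ≤ n * h Y := by gcongr
          _ ≤ _ := h1.trans h3
      have h5 : (2 * x / (2 * Y + C) - 1 / 2 ^ k) * h Y =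
        ((2 * (2 ^ k * x) / (2 * Y + C) - 1) * h Y) / 2 ^ k := by field_simp
      rw [h5, div_le_iff₀ (by positivity)]; linarith
    have ht : Tendsto (fun k : ℕ => (2 * x / (2 * Y + C) - 1 / 2 ^ k) * h Y) atTop
        (𝓝 ((2 * x / (2 * Y + C) - 0) * h Y)) := by
      apply Tendsto.mul_const
      apply Tendsto.sub tendsto_const_nhds
      exact p2.const_div_atTop 1
    have := le_of_tendsto ht hev
    simpa using this
  have L2 : ∀ x x' y : ℝ, 0 < x → x < x' → 0 < y → x / y * h y ≤ h x' := by
    intro x x' y hx hxx hy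
    have hj : ∀ j : ℕ, 2 * x / (2 * y + C / 2 ^ j) * h y ≤ h x' := by
      intro j
      have := L1 x x' (2 ^ j * y) hx hxx (by positivity)
      rw [H.pow j hy] at this
      refine le_trans (le_of_eq ?_) this
      field_simp
    have ht : Tendsto (fun j : ℕ => 2 * x / (2 * y + C / 2 ^ j) * h y) atTop
        (𝓝 (2 * x / (2 * y + 0) * h y)) := by
      apply Tendsto.mul_const
      apply Tendsto.div tendsto_const_nhds _ (by positivity)
      exact tendsto_const_nhds.add (p2.const_div_atTop C)
    have := le_of_tendsto' ht hj
    rwa [add_zero, mul_div_mul_left _ _ two_ne_zero] at this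
  have L3 : ∀ x y : ℝ, 0 < x → 0 < y → x / y * h y ≤ h x := by
    intro x y hx hy
    have ht : Tendsto (fun w : ℝ => w / y * h y) (𝓝[<] x) (𝓝 (x / y * h y)) := by
      apply Tendsto.mono_left _ nhdsWithin_le_nhds
      apply Continuous.tendsto; fun_prop
    refine le_of_tendsto ht ?_
    filter_upwards [Ioo_mem_nhdsLT hx] with w hw
    exact L2 w x y hw.1 hw.2 hy
  refine ⟨h 1, H.pos 1 one_pos, fun r hr => ?_⟩
  have h1 := L3 r 1 hr one_pos
  have h2 := L3 1 r one_pos hr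
  apply le_antisymm
  · rw [one_div, inv_mul_le_iff₀ hr] at h2; linarith
  · rw [div_one] at h1; linarith

end LDsec


section LDsec2
variable {m : Measure ℝ} {T : Set ℝ} {h : ℝ → ℝ} {D : ℝ}

lemma LD.add (H : LD m T h D) {a b c : ℝ} (hab : a ≤ b) (hbc : b ≤ c) :
    (m (Set.Ico a c)).toReal = (m (Set.Ico a b)).toReal + (m (Set.Ico b c)).toReal := by
  rw [← ENNReal.toReal_add (H.fin' _ _).ne (H.fin' _ _).ne, ← measure_union _ measurableSet_Ico,
    Set.Ico_union_Ico_eq_Ico hab hbc]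
  rw [Set.disjoint_left]
  rintro x ⟨_, h1⟩ ⟨h2, _⟩
  linarith

lemma LD.Ico_low (H : LD m T h D) {c : ℝ} (hc : ∀ r > 0, h r = c * r) {u r : ℝ} (hu : u ∈ T)
    (hr : 0 < r) : c * r ≤ (m (Set.Ico (u - r) (u + r))).toReal := by
  have h1 := (H.low u hu r hr).trans (measure_mono Set.Ioo_subset_Ico_self)
  rw [← hc r hr]
  exact (ENNReal.ofReal_le_iff_le_toReal (H.fin' _ _).ne).mp h1

lemma LD.Ico_up (H : LD m T h D) {c : ℝ} (hc0 : 0 < c) (hc : ∀ r > 0, h r = c * r) {u r : ℝ}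
    (hu : u ∈ T) (hr : 0 < r) :
    (m (Set.Ico (u - r) (u + r))).toReal ≤ c * Real.sqrt (r ^ 2 + D ^ 2) := by
  have h1 : ∀ R, r < R → (m (Set.Ico (u - r) (u + r))).toReal ≤ c * Real.sqrt (R ^ 2 + D ^ 2) := by
    intro R hR
    have h2 : m (Set.Ico (u - r) (u + r)) ≤ m (Set.Ioo (u - R) (u + R)) :=
      measure_mono fun x hx => ⟨by linarith [hx.1], by linarith [hx.2]⟩
    have hR0 : 0 < R := hr.trans hR
    have h3 := h2.trans (H.up u hu R hR0)
    rw [hc _ (by positivity)] at h3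
    exact ENNReal.toReal_le_of_le_ofReal (by positivity) h3
  have ht : Tendsto (fun R : ℝ => c * Real.sqrt (R ^ 2 + D ^ 2)) (𝓝[>] r)
      (𝓝 (c * Real.sqrt (r ^ 2 + D ^ 2))) := by
    apply Tendsto.mono_left _ nhdsWithin_le_nhds
    apply Continuous.tendsto; fun_prop
  refine ge_of_tendsto ht ?_
  filter_upwards [self_mem_nhdsWithin] with R hR using h1 R hR

lemma sqrt_excess (r D : ℝ) (hr : 0 < r) : Real.sqrt (r ^ 2 + D ^ 2) ≤ r + D ^ 2 / (2 * r) := by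
  apply Real.sqrt_le_iff.mpr ⟨by positivity, ?_⟩
  have : (r + D ^ 2 / (2 * r)) ^ 2 = r ^ 2 + D ^ 2 + (D ^ 2 / (2 * r)) ^ 2 := by
    field_simp; ring
  rw [this]
  nlinarith [sq_nonneg (D ^ 2 / (2 * r))]

lemma LD.exact (H : LD m T h D) {c : ℝ} (hc0 : 0 < c) (hc : ∀ r > 0, h r = c * r) {u r : ℝ}
    (hu : u ∈ T) (hr : 0 < r) : m (Set.Ioo (u - r) (u + r)) = ENNReal.ofReal (c * r) := by
  have hD := H.D0
  suffices hs : (m (Set.Ico (u - r) (u + r))).toReal ≤ c * r by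
    apply le_antisymm
    · refine (measure_mono Set.Ioo_subset_Ico_self).trans ?_
      exact (ENNReal.le_ofReal_iff_toReal_le (H.fin' _ _).ne (by positivity)).mpr hs
    · rw [← hc r hr]; exact H.low u hu r hr
  set C := 64 * D + 1 with hC
  have hC0 : 0 < C := by positivity
  obtain ⟨t, ht, ht1, -⟩ := H.dense hu hC0 (by linarith) (z := u + r + 1) (by linarith)
  -- bound with parameter N
  have key : ∀ N : ℝ, 0 < N → (m (Set.Ico (u - r) (u + r))).toReal ≤ c * r + c * D ^ 2 / N := by
    intro N hN
    obtain ⟨t', ht', ht1', -⟩ := H.dense hu hC0 (by linarith) (z := 2 * t - u + N + |u| + |t|)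
      (by have := le_abs_self u; have := le_abs_self t; have := abs_nonneg u; have := abs_nonneg t
          linarith)
    have hau := le_abs_self u
    have hau' := neg_abs_le u
    have hat := le_abs_self t
    have hat' := neg_abs_le t
    set z1 := u - r with hz1
    set z2 := u + r with hz2
    set τ := t' - t with hτ
    have g1 := H.Ico_low hc ht (r := t - z2) (by linarith)
    rw [show t - (t - z2) = z2 by ring] at g1
    have g2 := H.Ico_low hc ht' (r := t' - (t + (t - z2))) (by linarith)
    rw [show t' - (t' - (t + (t - z2))) = t + (t - z2) by ring,
      show t' + (t' - (t + (t - z2))) = z2 + 2 * τ by rw [hτ]; ring] at g2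
    have a1 := H.add (a := z2) (b := t + (t - z2)) (c := z2 + 2 * τ) (by linarith) (by linarith)
    have g3 := H.Ico_up hc0 hc ht' (r := t' - z1) (by linarith)
    rw [show t' - (t' - z1) = z1 by ring] at g3
    have g4 := H.Ico_low hc ht (r := t - (z1 - 2 * τ)) (by linarith)
    rw [show t - (t - (z1 - 2 * τ)) = z1 - 2 * τ by ring,
      show t + (t - (z1 - 2 * τ)) = t' + (t' - z1) by rw [hτ]; ring] at g4
    have a2 := H.add (a := z1 - 2 * τ) (b := z1) (c := t' + (t' - z1)) (by linarith) (by linarith)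
    have g5 := H.Ico_up hc0 hc hu (r := r + 2 * τ) (by linarith)
    rw [show u - (r + 2 * τ) = z1 - 2 * τ by rw [hz1]; ring,
      show u + (r + 2 * τ) = z2 + 2 * τ by rw [hz2]; ring] at g5
    have a3 := H.add (a := z1 - 2 * τ) (b := z1) (c := z2 + 2 * τ) (by linarith) (by linarith)
    have a4 := H.add (a := z1) (b := z2) (c := z2 + 2 * τ) (by linarith) (by linarith)
    have s1 := sqrt_excess (t' - z1) D (by linarith)
    have s2 := sqrt_excess (r + 2 * τ) D (by linarith)
    have s1' : D ^ 2 / (2 * (t' - z1)) ≤ D ^ 2 / (2 * N) := by gcongr; linarith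
    have s2' : D ^ 2 / (2 * (r + 2 * τ)) ≤ D ^ 2 / (2 * N) := by gcongr; linarith
    have f1 : c * Real.sqrt ((t' - z1) ^ 2 + D ^ 2) ≤ c * (t' - z1 + D ^ 2 / (2 * N)) := by
      gcongr; linarith
    have f2 : c * Real.sqrt ((r + 2 * τ) ^ 2 + D ^ 2) ≤ c * (r + 2 * τ + D ^ 2 / (2 * N)) := by
      gcongr; linarith
    have f3 : c * D ^ 2 / N = c * (D ^ 2 / (2 * N)) + c * (D ^ 2 / (2 * N)) := by
      field_simp; ring
    rw [f3]
    simp only [hz1, hz2, hτ] at *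
    nlinarith
  have ht : Tendsto (fun N : ℝ => c * r + c * D ^ 2 / N) atTop (𝓝 (c * r + 0)) :=
    tendsto_const_nhds.add (tendsto_id.const_div_atTop _)
  rw [add_zero] at ht
  refine ge_of_tendsto ht ?_
  filter_upwards [eventually_gt_atTop 0] with N hN using key N hN

lemma LD.classify (H : LD m T h D) : ∃ c : ℝ, 0 < c ∧ (∀ r > 0, h r = c * r) ∧ T = Set.univ ∧
    ∀ a b, a < b → m (Set.Ioo a b) = ENNReal.ofReal (c / 2 * (b - a)) := by
  obtain ⟨c, hc0, hc⟩ := H.linear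
  have hex := fun u (hu : u ∈ T) r hr => H.exact hc0 hc (u := u) (r := r) hu hr
  have H0 : LD m T h 0 :=
    { H with
      D0 := le_refl _
      up := by
        intro u hu r hr
        rw [hex u hu r hr]
        simp [Real.sqrt_sq hr.le, hc r hr] }
  have hright : ∀ z0 ∈ T, ∀ z, z0 ≤ z → z ∈ T := by
    intro z0 hz0 z hz
    rw [← H.closed.closure_eq]
    rw [Metric.mem_closure_iff]
    intro ε hε
    obtain ⟨u, hu, h1, h2⟩ := H0.dense hz0 (C := ε / 2) (by positivity) (by linarith) hz
    refine ⟨u, hu, ?_⟩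
    rw [dist_comm, Real.dist_eq, abs_of_nonneg (by linarith)]
    linarith
  have hT : T = Set.univ := by
    by_contra hne
    obtain ⟨x, hx⟩ := (Set.ne_univ_iff_exists_notMem T).mp hne
    have hbd : BddBelow T := ⟨x, fun y hy => by
      by_contra hc
      push Not at hc
      exact hx (hright y hy x hc.le)⟩
    have ht0 := H.closed.csInf_mem H.ne hbd
    set t0 := sInf T with ht0def
    have hmin : ∀ y ∈ T, t0 ≤ y := fun y hy => csInf_le hbd hy
    have hb : ∀ r > 0, m {t0} ≤ ENNReal.ofReal (c * r) := by
      intro r hr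
      rw [← hex t0 ht0 r hr]
      apply measure_mono
      intro y hy
      rw [Set.mem_singleton_iff] at hy
      subst hy
      constructor <;> linarith
    have h1 := hex t0 ht0 2 two_pos
    have h2 := hex (t0 + 1) (hright t0 ht0 _ (by linarith)) 1 one_pos
    rw [show t0 + 1 - 1 = t0 by ring, show t0 + 1 + 1 = t0 + 2 by ring] at h2
    have h3 : m (Set.Ioo (t0 - 2) (t0 + 2)) ≤ m ({t0} ∪ Set.Ioo t0 (t0 + 2)) := by
      apply H.cmp
      rintro y ⟨⟨_, hy2⟩, hyT⟩
      rcases (hmin y hyT).eq_or_lt with h | h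
      · left; exact h.symm
      · right; exact ⟨h, hy2⟩
    have h4 := h3.trans ((measure_union_le _ _).trans (add_le_add (hb (1 / 2) (by norm_num)) le_rfl))
    rw [h1, h2, ← ENNReal.ofReal_add (by positivity) (by positivity),
      ENNReal.ofReal_le_ofReal_iff (by positivity)] at h4
    linarith
  refine ⟨c, hc0, hc, hT, fun a b hab => ?_⟩
  have := hex ((a + b) / 2) (by rw [hT]; trivial) ((b - a) / 2) (by linarith)
  rw [show (a + b) / 2 - (b - a) / 2 = a by ring, show (a + b) / 2 + (b - a) / 2 = b by ring] at this
  rw [this]; congr 1; ring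

end LDsec2


section C3sec
variable {E : Type*} [NormedAddCommGroup E] [InnerProductSpace ℝ E] [FiniteDimensional ℝ E]
  [MeasurableSpace E] [BorelSpace E]
variable {μ : Measure E} {S : Set E} {h : ℝ → ℝ}

lemma UD.translate (H : UD μ S h) (p : E) :
    UD (μ.map (fun y => y - p)) ((fun y => y + p) ⁻¹' S) h where
  closed := H.closed.preimage (by fun_prop)
  ne := by
    obtain ⟨x, hx⟩ := H.ne
    exact ⟨x - p, by simpa using hx⟩
  null := by
    rw [Measure.map_apply (by fun_prop)
      (H.closed.preimage (by fun_prop : Continuous fun y : E => y + p)).measurableSet.compl]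
    convert H.null using 2
    ext x; simp
  ball := by
    intro x hx r hr
    rw [Measure.map_apply (by fun_prop) measurableSet_ball, ← H.ball _ hx r hr]
    congr 1
    ext y
    simp only [Set.mem_preimage, mem_ball, dist_eq_norm]
    rw [show y - p - x = y - (x + p) by abel]
  pos := H.pos
  dbl := H.dbl

lemma UD.tube (H : UD μ S h) : ∃ e : E, ‖e‖ = 1 ∧ ∃ D : ℝ, 0 ≤ D ∧ ∀ x ∈ S, ∀ y ∈ S,
    ‖(x - y) - (inner ℝ e (x - y) : ℝ) • e‖ ≤ D := by
  obtain ⟨p, hp⟩ := H.ne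
  obtain ⟨e, he, K, hK⟩ := (H.translate p).tube0 (by simpa using hp)
  have key : ∀ x ∈ S, ‖(x - p) - (inner ℝ e (x - p) : ℝ) • e‖ ≤ K := fun x hx =>
    hK (x - p) (by simpa using hx)
  have hK0 : 0 ≤ K := (norm_nonneg _).trans (key p hp)
  refine ⟨e, he, K + K, by linarith, fun x hx y hy => ?_⟩
  have : (x - y) - (inner ℝ e (x - y) : ℝ) • e =
      ((x - p) - (inner ℝ e (x - p) : ℝ) • e) - ((y - p) - (inner ℝ e (y - p) : ℝ) • e) := by
    simp only [inner_sub_right, sub_smul]; abel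
  rw [this]
  exact (norm_sub_le _ _).trans (add_le_add (key x hx) (key y hy))

lemma UD.toLD (H : UD μ S h) {e : E} (he : ‖e‖ = 1) {D : ℝ} (hD : 0 ≤ D)
    (ht : ∀ x ∈ S, ∀ y ∈ S, ‖(x - y) - (inner ℝ e (x - y) : ℝ) • e‖ ≤ D) :
    LD (μ.map (fun y => (inner ℝ e y : ℝ))) ((fun y => (inner ℝ e y : ℝ)) '' S) h D := by
  have hc : Continuous (fun y : E => (inner ℝ e y : ℝ)) := by fun_prop
  have hdist : ∀ x ∈ S, ∀ y ∈ S, ‖x - y‖ ^ 2 ≤ (inner ℝ e x - inner ℝ e y : ℝ) ^ 2 + D ^ 2 := by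
    intro x hx y hy
    have h1 := (perp_norm e (x - y) he).2
    have h2 := ht x hx y hy
    have h3 : ‖(x - y) - (inner ℝ e (x - y) : ℝ) • e‖ ^ 2 ≤ D ^ 2 := by gcongr
    rw [← inner_sub_right]
    linarith
  have hcl : IsClosed ((fun y => (inner ℝ e y : ℝ)) '' S) := by
    apply IsSeqClosed.isClosed
    intro u t hu hut
    choose x hx hxu using hu
    simp only at hxu
    have hb : ∃ M, ∀ n, |u n| ≤ M := by
      obtain ⟨M, hM⟩ := hut.norm.bddAbove_range
      exact ⟨M, fun n => hM ⟨n, rfl⟩⟩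
    obtain ⟨M, hM⟩ := hb
    have hbd : ∀ n, x n ∈ closedBall (x 0) (2 * M + D) := by
      intro n
      have h1 := hdist (x n) (hx n) (x 0) (hx 0)
      rw [mem_closedBall, dist_eq_norm]
      rw [hxu, hxu] at h1
      have hM0 : 0 ≤ M := (abs_nonneg _).trans (hM 0)
      have h2 := abs_le.mp (hM n)
      have h3 := abs_le.mp (hM 0)
      apply abs_le_of_sq_le_sq' _ (by positivity) |>.2
      have : (u n - u 0) ^ 2 ≤ (2 * M) ^ 2 := sq_le_sq' (by linarith) (by linarith)
      nlinarith [mul_nonneg hM0 hD]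
    obtain ⟨a, -, φ, hφ, hlim⟩ := tendsto_subseq_of_bounded isBounded_closedBall hbd
    refine ⟨a, H.closed.mem_of_tendsto hlim (Eventually.of_forall fun n => hx _), ?_⟩
    have h1 := (hc.tendsto a).comp hlim
    have h2 := hut.comp hφ.tendsto_atTop
    refine tendsto_nhds_unique h1 (h2.congr fun n => ?_)
    simp [hxu]
  refine ⟨hD, hcl, H.ne.image _, ?_, ?_, ?_, H.pos, H.dbl, fun a b => H.mono⟩
  · rw [Measure.map_apply hc.measurable hcl.measurableSet.compl]
    refine measure_mono_null ?_ H.null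
    intro y hy hyS
    exact hy ⟨y, hyS, rfl⟩
  · rintro _ ⟨x, hx, rfl⟩ r hr
    rw [Measure.map_apply hc.measurable measurableSet_Ioo, ← H.ball x hx r hr]
    refine measure_mono fun y hy => ?_
    rw [mem_ball, dist_eq_norm] at hy
    have h1 : |(inner ℝ e (y - x) : ℝ)| ≤ ‖y - x‖ := by
      simpa [he] using abs_real_inner_le_norm e (y - x)
    rw [inner_sub_right] at h1
    have := abs_lt.mp (h1.trans_lt hy)
    exact ⟨by linarith, by linarith⟩
  · rintro _ ⟨x, hx, rfl⟩ r hr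
    rw [Measure.map_apply hc.measurable measurableSet_Ioo, ← H.ball x hx _ (by positivity)]
    set A := (fun y => (inner ℝ e y : ℝ)) ⁻¹' Set.Ioo ((inner ℝ e x : ℝ) - r) ((inner ℝ e x : ℝ) + r)
    have : A ⊆ Metric.ball x (Real.sqrt (r ^ 2 + D ^ 2)) ∪ Sᶜ := by
      intro y hy
      by_cases hyS : y ∈ S
      · left
        rw [mem_ball, dist_eq_norm]
        apply Real.lt_sqrt_of_sq_lt
        have h1 := hdist y hyS x hx
        have h2 : (inner ℝ e y - inner ℝ e x : ℝ) ^ 2 < r ^ 2 :=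
          sq_lt_sq' (by have := hy.1; linarith) (by have := hy.2; linarith)
        linarith
      · exact Or.inr hyS
    calc μ A ≤ _ := measure_mono this
      _ ≤ _ := measure_union_le _ _
      _ = _ := by rw [H.null, add_zero]

lemma UD.line (H : UD μ S h) : ∃ e p : E, ‖e‖ = 1 ∧ ∃ c : ℝ, 0 < c ∧
    (∀ y ∈ S, y = p + ((inner ℝ e y : ℝ) - inner ℝ e p) • e) ∧
    ∀ a b, a < b → μ.map (fun y => (inner ℝ e y : ℝ)) (Set.Ioo a b) =
      ENNReal.ofReal (c / 2 * (b - a)) := by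
  obtain ⟨e, he, D, hD, ht⟩ := H.tube
  obtain ⟨p, hp⟩ := H.ne
  obtain ⟨c, hc, hh, -, hm⟩ := (H.toLD he hD ht).classify
  refine ⟨e, p, he, c, hc, ?_, hm⟩
  intro y hy
  by_contra hcon
  have hcont : Continuous (fun y : E => (inner ℝ e y : ℝ)) := by fun_prop
  have hw : 0 < ‖(y - p) - (inner ℝ e (y - p) : ℝ) • e‖ := by
    rw [norm_pos_iff]
    intro h0
    apply hcon
    rw [← inner_sub_right, ← sub_eq_zero, ← h0]; abel
  have hpn := (perp_norm e (y - p) he).2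
  have hlt : |(inner ℝ e (y - p) : ℝ)| < ‖y - p‖ := by
    apply abs_lt_of_sq_lt_sq _ (norm_nonneg _)
    nlinarith
  obtain ⟨R, hR1, hR2⟩ := exists_between hlt
  have hR : 0 < R := (abs_nonneg _).trans_lt hR1
  set g := min (R - |(inner ℝ e (y - p) : ℝ)|) (‖y - p‖ - R) with hg
  have hg0 : 0 < g := lt_min (by linarith) (by linarith)
  have hg1 : g ≤ R - |(inner ℝ e (y - p) : ℝ)| := min_le_left _ _
  have hg2 : g ≤ ‖y - p‖ - R := min_le_right _ _
  set A := (fun y => (inner ℝ e y : ℝ)) ⁻¹' Set.Ioo ((inner ℝ e p : ℝ) - R) ((inner ℝ e p : ℝ) + R)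
    with hA
  have hμA : μ A = ENNReal.ofReal (c * R) := by
    rw [hA, ← Measure.map_apply hcont.measurable measurableSet_Ioo, hm _ _ (by linarith)]
    congr 1; ring
  have hsub : Metric.ball p R ∪ Metric.ball y g ⊆ A := by
    rintro z (hz | hz)
    · rw [mem_ball, dist_eq_norm] at hz
      have h1 : |(inner ℝ e (z - p) : ℝ)| ≤ ‖z - p‖ := by
        simpa [he] using abs_real_inner_le_norm e (z - p)
      rw [inner_sub_right] at h1
      have := abs_lt.mp (h1.trans_lt hz)
      exact ⟨by linarith, by linarith⟩
    · rw [mem_ball, dist_eq_norm] at hz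
      have h1 : |(inner ℝ e (z - y) : ℝ)| ≤ ‖z - y‖ := by
        simpa [he] using abs_real_inner_le_norm e (z - y)
      rw [inner_sub_right] at h1 hg1
      have h2 := abs_lt.mp (h1.trans_lt hz)
      have h3 := neg_abs_le (inner ℝ e y - inner ℝ e p : ℝ)
      have h4 := le_abs_self (inner ℝ e y - inner ℝ e p : ℝ)
      exact ⟨by linarith, by linarith⟩
  have hdisj : Disjoint (Metric.ball p R) (Metric.ball y g) := by
    apply ball_disjoint_ball
    rw [dist_comm, dist_eq_norm]; linarith
  have h1 := measure_mono (μ := μ) hsub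
  rw [measure_union hdisj measurableSet_ball, H.ball p hp R hR, H.ball y hy g hg0, hμA, hh R hR,
    hh g hg0, ← ENNReal.ofReal_add (by positivity) (by positivity),
    ENNReal.ofReal_le_ofReal_iff (by positivity)] at h1
  have : 0 < c * g := by positivity
  linarith
end C3sec

lemma UD.flat {d : ℕ} {μ : Measure (EuclideanSpace ℝ (Fin d))} {S : Set (EuclideanSpace ℝ (Fin d))}
    {h : ℝ → ℝ} (H : UD μ S h) : IsFlat μ := by
  obtain ⟨e, p, he, c, hc, hS, hm⟩ := H.line
  have he0 : e ≠ 0 := by rintro rfl; simp at he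
  set L : Set (EuclideanSpace ℝ (Fin d)) := {y | ∃ t : ℝ, y = p + t • e} with hL
  set γ : ℝ → EuclideanSpace ℝ (Fin d) := fun t => p + (t - inner ℝ e p) • e with hγ
  have hiso : Isometry γ := by
    apply Isometry.of_dist_eq
    intro s t
    simp only [hγ]
    rw [dist_add_left, dist_eq_norm, ← sub_smul, norm_smul, he, Real.dist_eq, Real.norm_eq_abs]
    simp
  have hr : Set.range γ = L := by
    ext y
    constructor
    · rintro ⟨t, rfl⟩; exact ⟨_, rfl⟩
    · rintro ⟨t, rfl⟩; exact ⟨t + inner ℝ e p, by simp [hγ]⟩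
  have hcont : Continuous (fun y : EuclideanSpace ℝ (Fin d) => (inner ℝ e y : ℝ)) := by fun_prop
  have hmap : μ.map (fun y => (inner ℝ e y : ℝ)) = ENNReal.ofReal (c / 2) • volume := by
    have : IsLocallyFiniteMeasure (μ.map (fun y => (inner ℝ e y : ℝ))) :=
      ⟨fun x => ⟨Set.Ioo (x - 1) (x + 1), Ioo_mem_nhds (by linarith) (by linarith), by
        rw [hm _ _ (by linarith)]; exact ENNReal.ofReal_lt_top⟩⟩
    apply Real.measure_ext_Ioo_rat
    intro a b
    rcases lt_or_ge (a : ℝ) b with hab | hab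
    · rw [hm _ _ hab, Measure.smul_apply, Real.volume_Ioo, smul_eq_mul,
        ENNReal.ofReal_mul (by positivity)]
    · rw [Set.Ioo_eq_empty (by simpa using hab)]; simp
  have hback : μ = (μ.map (fun y => (inner ℝ e y : ℝ))).map γ := by
    rw [Measure.map_map hiso.continuous.measurable hcont.measurable]
    have : (γ ∘ fun y => (inner ℝ e y : ℝ)) =ᵐ[μ] id := by
      have h1 : ∀ᵐ y ∂μ, y ∈ S := H.null
      filter_upwards [h1] with y hy
      exact (hS y hy).symm
    rw [Measure.map_congr this, Measure.map_id]
  refine ⟨c / 2, by positivity, L, ⟨p, e, he0, rfl⟩, ?_⟩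
  rw [hback, hmap, Measure.map_smul, ← hausdorffMeasure_real,
    hiso.map_hausdorffMeasure (Or.inl zero_le_one), hr]


section A3sec
variable {E : Type*} [NormedAddCommGroup E] [InnerProductSpace ℝ E] [FiniteDimensional ℝ E]
  [MeasurableSpace E] [BorelSpace E]

lemma ball_left (ν : Measure E) [IsLocallyFiniteMeasure ν] (x : E) {r M : ℝ} (hr : 0 < r)
    (hM : ∀ s, 0 < s → s < r → (ν (ball x s)).toReal ≤ M) : (ν (ball x r)).toReal ≤ M := by
  have hM0 : 0 ≤ M := ENNReal.toReal_nonneg.trans (hM (r / 2) (by linarith) (by linarith))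
  have hU : ball x r = ⋃ n : ℕ, ball x (r - 1 / ((n : ℝ) + 1)) := by
    ext y
    simp only [Set.mem_iUnion, mem_ball]
    constructor
    · intro hy
      obtain ⟨n, hn⟩ := exists_nat_one_div_lt (show 0 < r - dist y x by linarith)
      exact ⟨n, by linarith⟩
    · rintro ⟨n, hn⟩
      have : 0 < 1 / ((n : ℝ) + 1) := by positivity
      linarith
  have hmono : Monotone fun n : ℕ => ball x (r - 1 / ((n : ℝ) + 1)) := by
    intro a b hab
    apply ball_subset_ball
    have := Nat.one_div_le_one_div (α := ℝ) hab
    linarith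
  refine ENNReal.toReal_le_of_le_ofReal hM0 ?_
  rw [hU, hmono.measure_iUnion]
  refine iSup_le fun n => ?_
  have hlt : r - 1 / ((n : ℝ) + 1) < r := by
    have : 0 < 1 / ((n : ℝ) + 1) := by positivity
    linarith
  rcases le_or_gt (r - 1 / ((n : ℝ) + 1)) 0 with h0 | h0
  · rw [ball_eq_empty.mpr h0]; simp
  · rw [← ENNReal.ofReal_toReal (measure_ball_lt_top (μ := ν) (x := x)).ne]
    exact ENNReal.ofReal_le_ofReal (hM _ h0 hlt)

lemma UD_of_limit (ν : Measure E) [IsLocallyFiniteMeasure ν] (hν0 : ν ≠ 0)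
    (hup : ∀ x ∈ ν.support, ∀ r1 r2, 0 < r1 → r1 < r2 →
      (ν (ball x (2 * r1))).toReal ≤ 2 * (ν (ball x r2)).toReal)
    (hlo : ∀ x ∈ ν.support, ∀ r1 r2, 0 < r1 → r1 < r2 →
      2 * (ν (ball x r1)).toReal ≤ (ν (ball x (2 * r2))).toReal) :
    ∃ h, UD ν ν.support h := by
  have hdbl : ∀ x ∈ ν.support, ∀ r, 0 < r →
      (ν (ball x (2 * r))).toReal = 2 * (ν (ball x r)).toReal := by
    intro x hx r hr
    apply le_antisymm
    · apply ball_left ν x (by positivity)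
      intro s hs hsr
      have := hup x hx (s / 2) r (by linarith) (by linarith)
      rwa [mul_div_cancel₀ _ (two_ne_zero)] at this
    · have : (ν (ball x r)).toReal ≤ (ν (ball x (2 * r))).toReal / 2 := by
        apply ball_left ν x hr
        intro s hs hsr
        have := hlo x hx s r hs hsr
        linarith
      linarith
  have hpow : ∀ x ∈ ν.support, ∀ (k : ℕ) r, 0 < r →
      (ν (ball x (2 ^ k * r))).toReal = 2 ^ k * (ν (ball x r)).toReal := by
    intro x hx k r hr
    induction k with
    | zero => simp
    | succ n ih => rw [pow_succ', mul_assoc, hdbl x hx _ (by positivity), ih]; ring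
  have hle : ∀ x ∈ ν.support, ∀ y ∈ ν.support, ∀ r, 0 < r →
      (ν (ball x r)).toReal ≤ (ν (ball y r)).toReal := by
    intro x hx y hy r hr
    apply ball_left ν x hr
    intro s hs hsr
    obtain ⟨k, hk⟩ := pow_unbounded_of_one_lt (dist x y / (r - s)) (one_lt_two)
    rw [div_lt_iff₀ (by linarith)] at hk
    have h1 : (ν (ball x (2 ^ k * s))).toReal ≤ (ν (ball y (2 ^ k * r))).toReal := by
      refine ENNReal.toReal_mono measure_ball_lt_top.ne (measure_mono (ball_subset_ball' ?_))
      linarith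
    rw [hpow x hx k s hs, hpow y hy k r hr] at h1
    exact le_of_mul_le_mul_left h1 (by positivity)
  obtain ⟨p, hp⟩ : ν.support.Nonempty := Measure.nonempty_support hν0
  refine ⟨fun r => (ν (ball p r)).toReal, Measure.isClosed_support, ⟨p, hp⟩,
    Measure.measure_compl_support, ?_, ?_, fun r hr => hdbl p hp r hr⟩
  · intro x hx r hr
    rw [← ENNReal.ofReal_toReal (measure_ball_lt_top (μ := ν) (x := x) (r := r)).ne]
    rw [le_antisymm (hle x hx p hp r hr) (hle p hp x hx r hr)]
  · intro r hr
    exact ENNReal.toReal_pos ((Measure.mem_support_iff_forall p).mp hp _ (ball_mem_nhds _ hr)).ne'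
      measure_ball_lt_top.ne
end A3sec

lemma distB_nonneg {d : ℕ} (B : Set (EuclideanSpace ℝ (Fin d)))
    (σ ν : Measure (EuclideanSpace ℝ (Fin d))) : 0 ≤ distB B σ ν :=
  Real.iSup_nonneg fun _ => abs_nonneg _

lemma exists_test {d : ℕ} {B : Set (EuclideanSpace ℝ (Fin d))}
    {σ ν : Measure (EuclideanSpace ℝ (Fin d))} {ε : ℝ} (hε : 0 < ε) (hflat : IsFlat ν)
    (h : ε ≤ distToFlat B σ) : ∃ f : EuclideanSpace ℝ (Fin d) → ℝ, LipschitzWith 1 f ∧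
      Function.support f ⊆ B ∧ ε / 2 < |(∫ x, f x ∂σ) - ∫ x, f x ∂ν| := by
  have h1 : distToFlat B σ ≤ distB B σ ν :=
    ciInf_le (f := fun τ : {σ : Measure (EuclideanSpace ℝ (Fin d)) // IsFlat σ} => distB B σ τ.1)
      ⟨0, by rintro _ ⟨τ, rfl⟩; exact distB_nonneg _ _ _⟩ ⟨ν, hflat⟩
  have h2 : ε / 2 < distB B σ ν := by linarith
  unfold distB at h2
  haveI : Nonempty {f : EuclideanSpace ℝ (Fin d) → ℝ // LipschitzWith 1 f ∧
      Function.support f ⊆ B} := ⟨⟨fun _ => 0, LipschitzWith.const' 0, by simp⟩⟩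
  obtain ⟨f, hf⟩ := exists_lt_of_lt_ciSup h2
  exact ⟨f.1, f.2.1, f.2.2, hf⟩

theorem stmt8 {d : ℕ} (hd : 1 ≤ d) (ε : ℝ) (hε : 0 < ε) :
    ∃ δ : ℝ, 0 < δ ∧
      ∀ μ : Measure (EuclideanSpace ℝ (Fin d)), IsLocallyFiniteMeasure μ →
      1 ≤ μ (closedBall (0 : EuclideanSpace ℝ (Fin d)) 1) →
      μ (ball (0 : EuclideanSpace ℝ (Fin d)) 2) ≤ 9 →
      (∫⁻ r in Set.Ioc δ δ⁻¹,
          (∫⁻ x in ball (0 : EuclideanSpace ℝ (Fin d)) δ⁻¹,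
            ENNReal.ofReal (ballDelta μ x r) ∂μ) / ENNReal.ofReal r) ≤
        ENNReal.ofReal (Real.sqrt δ) →
      distToFlat (ball (0 : EuclideanSpace ℝ (Fin d)) 2) μ < ε := by
  by_contra hcon
  push Not at hcon
  choose μ hlf h1 h9 hI hbad using fun k : ℕ =>
    hcon (1 / ((k : ℝ) + 1)) (by positivity)
  set δ : ℕ → ℝ := fun k => 1 / ((k : ℝ) + 1) with hδdef
  have hδ0 : ∀ k, 0 < δ k := fun k => by simp only [hδdef]; positivity
  let U : Ultrafilter ℕ := hyperfilter ℕ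
  have hU : (U : Filter ℕ) ≤ atTop := by
    rw [← Nat.cofinite_eq_atTop]; exact Filter.hyperfilter_le_cofinite
  have hδ : Tendsto δ U (𝓝 0) :=
    (tendsto_one_div_add_atTop_nhds_zero_nat (𝕜 := ℝ)).mono_left hU
  have hb : ∀ R : ℝ, ∃ C : ℝ, ∀ᶠ k in (U : Filter ℕ),
      (μ k) (closedBall 0 R) ≤ ENNReal.ofReal C := by
    intro R
    obtain ⟨C, δ0, hδ00, hC⟩ := growth d R
    refine ⟨C, ?_⟩
    filter_upwards [hδ.eventually (gt_mem_nhds hδ00)] with k hk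
    exact hC (μ k) (hlf k) (δ k) (hδ0 k) hk.le (h1 k) (h9 k) (hI k)
  obtain ⟨ν, hνlf, hν⟩ := exists_vague_limit U μ hlf hb
  have hν0 : ν ≠ 0 := by
    rintro rfl
    have ht := hν _ (cutoff_cont 0 1 2) (cutoff_compact 0 one_lt_two)
    simp only [integral_zero_measure] at ht
    obtain ⟨k, hk⟩ := (ht.eventually (gt_mem_nhds one_pos)).exists
    have h3 := le_cutoff_integral (μ k) (0 : EuclideanSpace ℝ (Fin d)) one_lt_two
    have h4 : (1 : ℝ) ≤ (μ k (closedBall 0 1)).toReal := by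
      have := ENNReal.toReal_mono (measure_closedBall_lt_top (μ := μ k)).ne (h1 k)
      simpa using this
    linarith
  obtain ⟨h, H⟩ := UD_of_limit ν hν0
    (fun x hx r1 r2 => limit_upper U μ hlf ν hν δ hδ0 hδ hI x hx r1 r2)
    (fun x hx r1 r2 => limit_lower U μ hlf ν hν δ hδ0 hδ hI x hx r1 r2)
  have hflat : IsFlat ν := H.flat
  choose f hf hs hgt using fun k => exists_test hε hflat (hbad k)
  have hzero : ∀ k x, x ∉ closedBall (0 : EuclideanSpace ℝ (Fin d)) 2 → f k x = 0 := by
    intro k x hx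
    by_contra h0
    exact hx (ball_subset_closedBall (hs k h0))
  have hlim : ∀ x, ∃ l, Tendsto (fun k => f k x) U (𝓝 l) := by
    intro x
    obtain ⟨z, hz⟩ : ∃ z : EuclideanSpace ℝ (Fin d), z ∉ closedBall (0 : EuclideanSpace ℝ (Fin d)) 2 := by
      refine ⟨EuclideanSpace.single ⟨0, hd⟩ (3 : ℝ), ?_⟩
      rw [mem_closedBall, dist_zero_right, PiLp.norm_single]
      norm_num
    refine ultra_lim U _ (dist x z) (Eventually.of_forall fun k => ?_)
    have := (hf k).dist_le_mul x z
    rw [hzero k z hz] at this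
    simpa [Real.dist_eq] using this
  choose g hg using hlim
  obtain ⟨C, hC⟩ := hb 2
  have t1 := tendsto_integral_lip U μ hlf ν hν 2 C hC f g hf hzero hg
  have t2 := tendsto_integral_lip U (fun _ => ν) (fun _ => hνlf) ν
    (fun _ _ _ => tendsto_const_nhds) 2 ((ν (closedBall 0 2)).toReal)
    (Eventually.of_forall fun _ => by
      rw [ENNReal.ofReal_toReal measure_closedBall_lt_top.ne]) f g hf hzero hg
  have t3 := (t1.sub t2).abs
  simp only [sub_self, abs_zero] at t3
  obtain ⟨k, hk⟩ := (t3.eventually (gt_mem_nhds (half_pos hε))).exists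
  exact absurd hk (not_lt.mpr (hgt k).le)
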